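/- As t → ∞, u(x,t) → A uniformly in x ∈ [0,1], and ∫₀¹ θ(x,t) dx → A. -/

import Mathlib

open MeasureTheory Real Set Filter Topology

/-- A classical solution on `[0,1] × [0,∞)` of the rescaled stress-free
one-dimensional compressible Navier–Stokes system
`u_t + u = v_x`, `v_t = ((v_x - θ)/u)_x`,
`θ_t = -θ v_x/u + v_x²/u + (θ^β θ_x/u)_x` (β > 0),
with stress-free, thermally insulated boundary conditions and positive data. -/
structure NSSol where
  β : ℝ
  hβ : 0 < β
  u : ℝ → ℝ → ℝ
  v : ℝ → ℝ → ℝ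
  θ : ℝ → ℝ → ℝ
  ux : ℝ → ℝ → ℝ
  ut : ℝ → ℝ → ℝ
  vx : ℝ → ℝ → ℝ
  vt : ℝ → ℝ → ℝ
  vxx : ℝ → ℝ → ℝ
  θx : ℝ → ℝ → ℝ
  θt : ℝ → ℝ → ℝ
  θxx : ℝ → ℝ → ℝ
  hu_pos : ∀ x ∈ Icc (0:ℝ) 1, ∀ t ∈ Ici (0:ℝ), 0 < u x t
  hθ_pos : ∀ x ∈ Icc (0:ℝ) 1, ∀ t ∈ Ici (0:ℝ), 0 < θ x t
  hux : ∀ x ∈ Icc (0:ℝ) 1, ∀ t ∈ Ici (0:ℝ),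
    HasDerivWithinAt (fun y => u y t) (ux x t) (Icc 0 1) x
  hut : ∀ x ∈ Icc (0:ℝ) 1, ∀ t ∈ Ici (0:ℝ),
    HasDerivWithinAt (fun s => u x s) (ut x t) (Ici 0) t
  hvx : ∀ x ∈ Icc (0:ℝ) 1, ∀ t ∈ Ici (0:ℝ),
    HasDerivWithinAt (fun y => v y t) (vx x t) (Icc 0 1) x
  hvt : ∀ x ∈ Icc (0:ℝ) 1, ∀ t ∈ Ici (0:ℝ),
    HasDerivWithinAt (fun s => v x s) (vt x t) (Ici 0) t
  hvxx : ∀ x ∈ Icc (0:ℝ) 1, ∀ t ∈ Ici (0:ℝ),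
    HasDerivWithinAt (fun y => vx y t) (vxx x t) (Icc 0 1) x
  hθx : ∀ x ∈ Icc (0:ℝ) 1, ∀ t ∈ Ici (0:ℝ),
    HasDerivWithinAt (fun y => θ y t) (θx x t) (Icc 0 1) x
  hθt : ∀ x ∈ Icc (0:ℝ) 1, ∀ t ∈ Ici (0:ℝ),
    HasDerivWithinAt (fun s => θ x s) (θt x t) (Ici 0) t
  hθxx : ∀ x ∈ Icc (0:ℝ) 1, ∀ t ∈ Ici (0:ℝ),
    HasDerivWithinAt (fun y => θx y t) (θxx x t) (Icc 0 1) x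
  hu_cont : ContinuousOn (Function.uncurry u) (Icc 0 1 ×ˢ Ici 0)
  hv_cont : ContinuousOn (Function.uncurry v) (Icc 0 1 ×ˢ Ici 0)
  hθ_cont : ContinuousOn (Function.uncurry θ) (Icc 0 1 ×ˢ Ici 0)
  hux_cont : ContinuousOn (Function.uncurry ux) (Icc 0 1 ×ˢ Ici 0)
  hut_cont : ContinuousOn (Function.uncurry ut) (Icc 0 1 ×ˢ Ici 0)
  hvx_cont : ContinuousOn (Function.uncurry vx) (Icc 0 1 ×ˢ Ici 0)
  hvt_cont : ContinuousOn (Function.uncurry vt) (Icc 0 1 ×ˢ Ici 0)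
  hvxx_cont : ContinuousOn (Function.uncurry vxx) (Icc 0 1 ×ˢ Ici 0)
  hθx_cont : ContinuousOn (Function.uncurry θx) (Icc 0 1 ×ˢ Ici 0)
  hθt_cont : ContinuousOn (Function.uncurry θt) (Icc 0 1 ×ˢ Ici 0)
  hθxx_cont : ContinuousOn (Function.uncurry θxx) (Icc 0 1 ×ˢ Ici 0)
  mass : ∀ x ∈ Icc (0:ℝ) 1, ∀ t ∈ Ici (0:ℝ), ut x t + u x t = vx x t
  momentum : ∀ x ∈ Icc (0:ℝ) 1, ∀ t ∈ Ici (0:ℝ),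
    HasDerivWithinAt (fun y => (vx y t - θ y t) / u y t) (vt x t) (Icc 0 1) x
  energyEq : ∀ x ∈ Icc (0:ℝ) 1, ∀ t ∈ Ici (0:ℝ),
    HasDerivWithinAt (fun y => θ y t ^ β * θx y t / u y t)
      (θt x t + θ x t * vx x t / u x t - (vx x t) ^ 2 / u x t) (Icc 0 1) x
  bc0 : ∀ t ∈ Ici (0:ℝ), (vx 0 t - θ 0 t) / u 0 t = 0
  bc1 : ∀ t ∈ Ici (0:ℝ), (vx 1 t - θ 1 t) / u 1 t = 0
  bcθ0 : ∀ t ∈ Ici (0:ℝ), θx 0 t = 0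
  bcθ1 : ∀ t ∈ Ici (0:ℝ), θx 1 t = 0

namespace NSSol

/-- The initial energy `E₀ = ∫₀¹ (v₀²/2 + θ₀) dx`. -/
noncomputable def E₀ (S : NSSol) : ℝ := ∫ x in (0:ℝ)..1, ((S.v x 0) ^ 2 / 2 + S.θ x 0)

/-- The dissipation functional
`V(t) = ∫₀¹ (θ^β θ_x²/(uθ²) + (v_x − θ)²/(uθ)) dx`. -/
noncomputable def V (S : NSSol) (t : ℝ) : ℝ :=
  ∫ x in (0:ℝ)..1,
    (S.θ x t ^ S.β * (S.θx x t) ^ 2 / (S.u x t * (S.θ x t) ^ 2)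
      + (S.vx x t - S.θ x t) ^ 2 / (S.u x t * S.θ x t))

/-- The auxiliary velocity
`w(x,t) = v(x,t) − ∫₀¹ v₀ dξ − ∫₀ˣ u(ξ,t) dξ + ∫₀¹∫₀^ξ u(η,t) dη dξ`,
which satisfies `w_x = v_x − u` and `∫₀¹ w dx = 0`. -/
noncomputable def w (S : NSSol) (x t : ℝ) : ℝ :=
  S.v x t - (∫ ξ in (0:ℝ)..1, S.v ξ 0) - (∫ ξ in (0:ℝ)..x, S.u ξ t)
    + ∫ ξ in (0:ℝ)..1, ∫ η in (0:ℝ)..ξ, S.u η t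

/-- The asymptotic state `A = 2√(36 + 3(2E₀ − (∫₀¹ v₀ dx)²)) − 12`. -/
noncomputable def A (S : NSSol) : ℝ :=
  2 * Real.sqrt (36 + 3 * (2 * S.E₀ - (∫ x in (0:ℝ)..1, S.v x 0) ^ 2)) - 12

end NSSol

/-! ### Calculus on the unit interval and the half-cylinder `[0,1] × [0,∞)` -/

lemma integrable_unit {f : ℝ → ℝ} (hf : ContinuousOn f (Icc 0 1)) :
    IntervalIntegrable f volume 0 1 :=
  hf.intervalIntegrable_of_Icc zero_le_one

lemma integral_unit_mono {f g : ℝ → ℝ} (hf : ContinuousOn f (Icc 0 1))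
    (hg : ContinuousOn g (Icc 0 1)) (h : ∀ x ∈ Icc (0:ℝ) 1, f x ≤ g x) :
    ∫ x in (0:ℝ)..1, f x ≤ ∫ x in (0:ℝ)..1, g x :=
  intervalIntegral.integral_mono_on zero_le_one (integrable_unit hf) (integrable_unit hg) h

lemma integral_unit_congr {f g : ℝ → ℝ} (h : ∀ x ∈ Icc (0:ℝ) 1, f x = g x) :
    ∫ x in (0:ℝ)..1, f x = ∫ x in (0:ℝ)..1, g x :=
  intervalIntegral.integral_congr fun x hx => h x (by rwa [uIcc_of_le zero_le_one] at hx)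

lemma integral_unit_add {f g : ℝ → ℝ} (hf : ContinuousOn f (Icc 0 1))
    (hg : ContinuousOn g (Icc 0 1)) :
    ∫ x in (0:ℝ)..1, (f x + g x) = (∫ x in (0:ℝ)..1, f x) + ∫ x in (0:ℝ)..1, g x :=
  intervalIntegral.integral_add (integrable_unit hf) (integrable_unit hg)

lemma integral_unit_sub {f g : ℝ → ℝ} (hf : ContinuousOn f (Icc 0 1))
    (hg : ContinuousOn g (Icc 0 1)) :
    ∫ x in (0:ℝ)..1, (f x - g x) = (∫ x in (0:ℝ)..1, f x) - ∫ x in (0:ℝ)..1, g x :=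
  intervalIntegral.integral_sub (integrable_unit hf) (integrable_unit hg)

/-- A subinterval integral is dominated by the integral over `[0,1]` of a majorant. -/
lemma abs_integral_sub_le {f g : ℝ → ℝ} (hf : ContinuousOn f (Icc 0 1))
    (hg : ContinuousOn g (Icc 0 1)) (h : ∀ x ∈ Icc (0:ℝ) 1, |f x| ≤ g x) {a b : ℝ}
    (ha : a ∈ Icc (0:ℝ) 1) (hb : b ∈ Icc (0:ℝ) 1) (hab : a ≤ b) :
    |∫ x in a..b, f x| ≤ ∫ x in (0:ℝ)..1, g x := by
  have hsub : Icc a b ⊆ Icc 0 1 := Icc_subset_Icc ha.1 hb.2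
  calc |∫ x in a..b, f x| ≤ ∫ x in a..b, |f x| :=
        intervalIntegral.abs_integral_le_integral_abs hab
    _ ≤ ∫ x in a..b, g x :=
        intervalIntegral.integral_mono_on hab
          ((hf.mono hsub).abs.intervalIntegrable_of_Icc hab)
          ((hg.mono hsub).intervalIntegrable_of_Icc hab) fun x hx => h x (hsub hx)
    _ ≤ ∫ x in (0:ℝ)..1, g x := by
        refine intervalIntegral.integral_mono_interval ha.1 hab hb.2 ?_ (integrable_unit hg)
        refine (ae_restrict_iff' measurableSet_Ioc).2 (Eventually.of_forall fun x hx => ?_)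
        exact (abs_nonneg _).trans (h x ⟨hx.1.le, hx.2⟩)

lemma integral_eq_sub_of_hasDerivWithinAt_unit {G G' : ℝ → ℝ}
    (hd : ∀ x ∈ Icc (0:ℝ) 1, HasDerivWithinAt G (G' x) (Icc 0 1) x)
    (hc : ContinuousOn G' (Icc 0 1)) {a b : ℝ} (ha : 0 ≤ a) (hab : a ≤ b) (hb : b ≤ 1) :
    ∫ x in a..b, G' x = G b - G a := by
  have hsub : Icc a b ⊆ Icc 0 1 := Icc_subset_Icc ha hb
  refine intervalIntegral.integral_eq_sub_of_hasDerivAt_of_le hab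
    (fun x hx => ((hd x (hsub hx)).continuousWithinAt).mono hsub) (fun x hx => ?_)
    ((hc.mono hsub).intervalIntegrable_of_Icc hab)
  exact (hd x (hsub ⟨hx.1.le, hx.2.le⟩)).hasDerivAt
    (Icc_mem_nhds (ha.trans_lt hx.1) (hx.2.trans_le hb))

lemma slice_continuousOn {F : ℝ × ℝ → ℝ} (hF : ContinuousOn F (Icc 0 1 ×ˢ Ici 0)) {t : ℝ}
    (ht : 0 ≤ t) : ContinuousOn (fun x => F (x, t)) (Icc 0 1) :=
  hF.comp (by fun_prop) fun _ hx => ⟨hx, ht⟩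

lemma hasDerivAt_integral_param {F F' : ℝ → ℝ → ℝ}
    (hF : ContinuousOn (fun p : ℝ × ℝ => F p.1 p.2) (Icc 0 1 ×ˢ Ici 0))
    (hF' : ContinuousOn (fun p : ℝ × ℝ => F' p.1 p.2) (Icc 0 1 ×ˢ Ici 0))
    (hd : ∀ x ∈ Icc (0:ℝ) 1, ∀ t > 0, HasDerivAt (F x) (F' x t) t)
    {x : ℝ} (hx : x ∈ Icc (0:ℝ) 1) {t : ℝ} (ht : 0 < t) :
    HasDerivAt (fun s => ∫ y in (0:ℝ)..x, F y s) (∫ y in (0:ℝ)..x, F' y t) t := by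
  have hsub : Icc (t / 2) (2 * t) ⊆ Ici 0 := fun s hs => (by linarith [hs.1] : (0:ℝ) ≤ s)
  obtain ⟨M, hM⟩ := ((isCompact_Icc (a := (0:ℝ)) (b := 1)).prod
    (isCompact_Icc (a := t / 2) (b := 2 * t))).exists_bound_of_continuousOn
      (hF'.mono (prod_mono_right hsub))
  have hxs : Icc 0 x ⊆ Icc 0 1 := Icc_subset_Icc_right hx.2
  have hioc : ∀ y, y ∈ uIoc 0 x → y ∈ Icc (0:ℝ) 1 := fun y hy => by
    rw [uIoc_of_le hx.1] at hy
    exact ⟨hy.1.le, hy.2.trans hx.2⟩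
  have hint : ∀ {G : ℝ → ℝ → ℝ},
      ContinuousOn (fun p : ℝ × ℝ => G p.1 p.2) (Icc 0 1 ×ˢ Ici 0) → ∀ s, 0 ≤ s →
      IntervalIntegrable (fun y => G y s) volume 0 x := fun hG s hs =>
    ((slice_continuousOn hG hs).mono hxs).intervalIntegrable_of_Icc hx.1
  refine (intervalIntegral.hasDerivAt_integral_of_dominated_loc_of_deriv_le
    (F := fun s y => F y s) (F' := fun s y => F' y s) (bound := fun _ => M)
    (Icc_mem_nhds (by linarith : t / 2 < t) (by linarith : t < 2 * t)) ?_ (hint hF t ht.le)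
    ((hint hF' t ht.le).aestronglyMeasurable_restrict_uIoc) ?_
    intervalIntegrable_const ?_).2
  · filter_upwards [lt_mem_nhds ht] with s hs
    exact (hint hF s hs.le).aestronglyMeasurable_restrict_uIoc
  · exact Eventually.of_forall fun y hy s hs => hM (y, s) ⟨hioc y hy, hs⟩
  · exact Eventually.of_forall fun y hy s hs => hd y (hioc y hy) s (by linarith [hs.1])

lemma continuousOn_integral_param {F : ℝ → ℝ → ℝ}
    (hF : ContinuousOn (fun p : ℝ × ℝ => F p.1 p.2) (Icc 0 1 ×ˢ Ici 0)) :
    ContinuousOn (fun p : ℝ × ℝ => ∫ y in (0:ℝ)..p.1, F y p.2) (Icc 0 1 ×ˢ Ici 0) := by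
  have hc : Continuous fun q : (ℝ × ℝ) × ℝ => F (max 0 (min 1 q.2)) (max 0 q.1.2) :=
    hF.comp_continuous
      (f := fun q : (ℝ × ℝ) × ℝ => (max 0 (min 1 q.2), max 0 q.1.2)) (by fun_prop)
      fun q => ⟨⟨le_max_left _ _, max_le zero_le_one (min_le_left _ _)⟩,
        mem_Ici.2 (le_max_left _ _)⟩
  refine (intervalIntegral.continuous_parametric_intervalIntegral_of_continuous
    (μ := volume) (a₀ := 0) (f := fun p y => F (max 0 (min 1 y)) (max 0 p.2)) hc
    continuous_fst).continuousOn.congr fun p hp => ?_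
  refine intervalIntegral.integral_congr fun y hy => ?_
  rw [uIcc_of_le hp.1.1] at hy
  have hp2 : (0:ℝ) ≤ p.2 := hp.2
  simp [hp2, hy.1, hy.2.trans hp.1.2]

lemma continuousOn_integral_unit {F : ℝ → ℝ → ℝ}
    (hF : ContinuousOn (fun p : ℝ × ℝ => F p.1 p.2) (Icc 0 1 ×ˢ Ici 0)) :
    ContinuousOn (fun t => ∫ y in (0:ℝ)..1, F y t) (Ici 0) :=
  (continuousOn_integral_param hF).comp (f := fun t : ℝ => ((1:ℝ), t)) (by fun_prop)
    fun _ ht => ⟨⟨zero_le_one, le_rfl⟩, ht⟩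

lemma eq_of_hasDerivAt_zero {g : ℝ → ℝ} (hc : ContinuousOn g (Ici 0))
    (hd : ∀ t > 0, HasDerivAt g 0 t) {t : ℝ} (ht : 0 ≤ t) : g t = g 0 := by
  have hdiff : DifferentiableOn ℝ g (interior (Ici 0)) := fun s hs => by
    rw [interior_Ici] at hs
    exact (hd s hs).differentiableAt.differentiableWithinAt
  have hderiv : ∀ s ∈ interior (Ici (0:ℝ)), deriv g s = 0 := fun s hs => by
    rw [interior_Ici] at hs
    exact (hd s hs).deriv
  exact le_antisymm
    (antitoneOn_of_deriv_nonpos (convex_Ici 0) hc hdiff (fun s hs => (hderiv s hs).le)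
      self_mem_Ici ht ht)
    (monotoneOn_of_deriv_nonneg (convex_Ici 0) hc hdiff (fun s hs => (hderiv s hs).ge)
      self_mem_Ici ht ht)

/-- Linear damping wins against an integrable forcing `C H'`, uniformly over all functions
with a common upper bound. -/
lemma eventually_le_of_damped {H V : ℝ → ℝ} {l : ℝ} (hH : ∀ t > 0, HasDerivAt H (V t) t)
    (hl : Tendsto H atTop (𝓝 l)) (C T Y : ℝ) {ε : ℝ} (hε : 0 < ε) :
    ∃ T' ≥ T, ∀ y y' : ℝ → ℝ, (∀ t ≥ T, HasDerivAt y (y' t) t) →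
      (∀ t ≥ T, y' t + y t ≤ ε + C * V t) → (∀ t ≥ T, y t ≤ Y) → ∀ t ≥ T', y t ≤ 4 * ε := by
  have hsmall : ∀ᶠ t in atTop, |C * (H t - l)| < ε := by
    have : Tendsto (fun t => |C * (H t - l)|) atTop (𝓝 |C * (l - l)|) :=
      ((hl.sub_const l).const_mul C).abs
    rw [sub_self, mul_zero, abs_zero] at this
    exact this.eventually (gt_mem_nhds hε)
  obtain ⟨T₁, hT₁⟩ := eventually_atTop.1
    (hsmall.and ((eventually_ge_atTop T).and (eventually_gt_atTop 0)))
  have hdecay : ∀ᶠ t in atTop, rexp (T₁ - t) * |Y| < ε := by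
    have h1 : Tendsto (fun t : ℝ => rexp (T₁ - t) * |Y|) atTop (𝓝 (0 * |Y|)) :=
      (tendsto_exp_atBot.comp (tendsto_atBot_add_const_left _ T₁ tendsto_neg_atTop_atBot)).mul_const
        _
    rw [zero_mul] at h1
    exact h1.eventually (gt_mem_nhds hε)
  obtain ⟨T₂, hT₂⟩ := eventually_atTop.1 (hdecay.and (eventually_ge_atTop T₁))
  refine ⟨T₂, (hT₁ T₁ le_rfl).2.1.trans (hT₂ T₂ le_rfl).2, fun y y' hy hode hY t ht => ?_⟩
  set g : ℝ → ℝ := fun s => rexp s * (y s - C * (H s - l) - 2 * ε) with hg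
  have hgd : ∀ s ≥ T₁, HasDerivAt g
      (rexp s * (y s - C * (H s - l) - 2 * ε) + rexp s * (y' s - C * V s)) s := fun s hs =>
    (Real.hasDerivAt_exp s).mul (((hy s (hT₁ s hs).2.1).sub
      (((hH s (hT₁ s hs).2.2).sub_const l).const_mul C)).sub_const (2 * ε))
  have hanti : AntitoneOn g (Ici T₁) := by
    refine antitoneOn_of_deriv_nonpos (convex_Ici T₁)
      (fun s hs => (hgd s hs).continuousAt.continuousWithinAt) (fun s hs => ?_) (fun s hs => ?_)
    all_goals rw [interior_Ici] at hs
    · exact (hgd s hs.le).differentiableAt.differentiableWithinAt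
    · have hs' : s ≥ T₁ := le_of_lt hs
      rw [(hgd s hs').deriv, ← mul_add]
      have h1 := hode s (hT₁ s hs').2.1
      have h2 := (abs_lt.1 (hT₁ s hs').1).1
      exact mul_nonpos_of_nonneg_of_nonpos (exp_pos s).le (by linarith)
  have htT : t ≥ T₁ := (hT₂ t ht).2
  have hcomp : g t ≤ g T₁ := hanti self_mem_Ici htT htT
  have h1 : y t - C * (H t - l) - 2 * ε ≤ rexp (T₁ - t) * (y T₁ - C * (H T₁ - l) - 2 * ε) := by
    have h3 : rexp (T₁ - t) * (y T₁ - C * (H T₁ - l) - 2 * ε) = rexp (-t) * g T₁ := by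
      rw [hg, sub_eq_add_neg, add_comm, Real.exp_add]
      ring
    have h4 : y t - C * (H t - l) - 2 * ε = rexp (-t) * g t := by
      simp only [hg]
      rw [← mul_assoc, ← Real.exp_add, neg_add_cancel, Real.exp_zero, one_mul]
    rw [h3, h4]
    exact mul_le_mul_of_nonneg_left hcomp (exp_pos _).le
  have h2 : rexp (T₁ - t) * (y T₁ - C * (H T₁ - l) - 2 * ε) ≤ rexp (T₁ - t) * |Y| := by
    refine mul_le_mul_of_nonneg_left ?_ (exp_pos _).le
    have h5 := (abs_lt.1 (hT₁ T₁ le_rfl).1).1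
    have h6 := hY T₁ (hT₁ T₁ le_rfl).2.1
    linarith [le_abs_self Y]
  have h7 := (abs_lt.1 (hT₁ t htT).1).2
  linarith [(hT₂ t ht).1]

namespace NSSol

variable (S : NSSol)

/-- The effective viscous stress `(v_x - θ)/u`. -/
noncomputable def stress (x t : ℝ) : ℝ := (S.vx x t - S.θ x t) / S.u x t

/-- The conserved mean velocity. -/
noncomputable def meanV : ℝ := ∫ x in (0:ℝ)..1, S.v x 0

noncomputable def meanθ (t : ℝ) : ℝ := ∫ x in (0:ℝ)..1, S.θ x t

/-- The slope of the `L²`-best affine approximation of `v(·,t)`. -/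
noncomputable def slope (t : ℝ) : ℝ := 12 * ∫ x in (0:ℝ)..1, (x - 1 / 2) * S.v x t

/-- The entropy, a primitive in time of the dissipation `V`. -/
noncomputable def entropy (t : ℝ) : ℝ := (∫ x in (0:ℝ)..1, Real.log (S.θ x t)) + S.slope t / 12

/-- The deviation of `v` from its best affine approximation. -/
noncomputable def residual (x t : ℝ) : ℝ := S.v x t - S.meanV - S.slope t * (x - 1 / 2)

/-- The kinetic energy of the residual, written through the conservation laws. -/
noncomputable def gap (t : ℝ) : ℝ :=
  S.E₀ - S.meanV ^ 2 / 2 - S.meanθ t - S.slope t ^ 2 / 24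

/-- The primitive of the deviation of `v` from its expected limit. -/
noncomputable def phase (x t : ℝ) : ℝ :=
  ∫ y in (0:ℝ)..x, (S.v y t - S.meanV - S.A * (y - 1 / 2))

/-- The specific volume with the phase removed. -/
noncomputable def vol (x t : ℝ) : ℝ := S.u x t * rexp (-S.phase x t)

/-- The density of the dissipation `V`. -/
noncomputable def dissip (x t : ℝ) : ℝ :=
  S.θ x t ^ S.β * (S.θx x t) ^ 2 / (S.u x t * (S.θ x t) ^ 2)
    + (S.vx x t - S.θ x t) ^ 2 / (S.u x t * S.θ x t)

lemma continuousOn_cylinder :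
    ContinuousOn (fun p : ℝ × ℝ => S.u p.1 p.2) (Icc 0 1 ×ˢ Ici 0) ∧
    ContinuousOn (fun p : ℝ × ℝ => S.v p.1 p.2) (Icc 0 1 ×ˢ Ici 0) ∧
    ContinuousOn (fun p : ℝ × ℝ => S.θ p.1 p.2) (Icc 0 1 ×ˢ Ici 0) ∧
    ContinuousOn (fun p : ℝ × ℝ => S.vx p.1 p.2) (Icc 0 1 ×ˢ Ici 0) ∧
    ContinuousOn (fun p : ℝ × ℝ => S.vt p.1 p.2) (Icc 0 1 ×ˢ Ici 0) ∧
    ContinuousOn (fun p : ℝ × ℝ => S.θx p.1 p.2) (Icc 0 1 ×ˢ Ici 0) ∧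
    ContinuousOn (fun p : ℝ × ℝ => S.θt p.1 p.2) (Icc 0 1 ×ˢ Ici 0) ∧
    (∀ p ∈ (Icc 0 1 ×ˢ Ici 0 : Set (ℝ × ℝ)), S.u p.1 p.2 ≠ 0) ∧
    ∀ p ∈ (Icc 0 1 ×ˢ Ici 0 : Set (ℝ × ℝ)), S.θ p.1 p.2 ≠ 0 :=
  ⟨S.hu_cont, S.hv_cont, S.hθ_cont, S.hvx_cont, S.hvt_cont, S.hθx_cont, S.hθt_cont,
    fun p hp => (S.hu_pos p.1 hp.1 p.2 hp.2).ne', fun p hp => (S.hθ_pos p.1 hp.1 p.2 hp.2).ne'⟩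

lemma continuousOn_slice {t : ℝ} (ht : 0 ≤ t) :
    ContinuousOn (fun x => S.u x t) (Icc 0 1) ∧ ContinuousOn (fun x => S.v x t) (Icc 0 1) ∧
    ContinuousOn (fun x => S.θ x t) (Icc 0 1) ∧ ContinuousOn (fun x => S.vx x t) (Icc 0 1) ∧
    ContinuousOn (fun x => S.vt x t) (Icc 0 1) ∧ ContinuousOn (fun x => S.θx x t) (Icc 0 1) ∧
    ContinuousOn (fun x => S.θt x t) (Icc 0 1) ∧ (∀ x ∈ Icc (0:ℝ) 1, S.u x t ≠ 0) ∧
    ∀ x ∈ Icc (0:ℝ) 1, S.θ x t ≠ 0 := by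
  obtain ⟨hu, hv, hθ, hvx, hvt, hθx, hθt, hu0, hθ0⟩ := S.continuousOn_cylinder
  exact ⟨slice_continuousOn hu ht, slice_continuousOn hv ht, slice_continuousOn hθ ht,
    slice_continuousOn hvx ht, slice_continuousOn hvt ht, slice_continuousOn hθx ht,
    slice_continuousOn hθt ht, fun x hx => hu0 (x, t) ⟨hx, ht⟩, fun x hx => hθ0 (x, t) ⟨hx, ht⟩⟩

lemma continuousOn_stress {t : ℝ} (ht : 0 ≤ t) :
    ContinuousOn (fun x => S.stress x t) (Icc 0 1) := by
  obtain ⟨hu, hv, hθ, hvx, hvt, hθx, hθt, hu0, hθ0⟩ := S.continuousOn_slice ht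
  unfold stress
  fun_prop (disch := assumption)

lemma continuousOn_rpow {t : ℝ} (ht : 0 ≤ t) (r : ℝ) :
    ContinuousOn (fun x => S.θ x t ^ r) (Icc 0 1) := by
  obtain ⟨hu, hv, hθ, hvx, hvt, hθx, hθt, hu0, hθ0⟩ := S.continuousOn_slice ht
  exact hθ.rpow_const fun x hx => Or.inl (hθ0 x hx)

lemma continuousOn_dissip {t : ℝ} (ht : 0 ≤ t) :
    ContinuousOn (fun x => S.dissip x t) (Icc 0 1) := by
  obtain ⟨hu, hv, hθ, hvx, hvt, hθx, hθt, hu0, hθ0⟩ := S.continuousOn_slice ht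
  have hr := S.continuousOn_rpow ht S.β
  have h1 : ∀ x ∈ Icc (0:ℝ) 1, S.u x t * S.θ x t ^ 2 ≠ 0 := fun x hx =>
    mul_ne_zero (hu0 x hx) (pow_ne_zero 2 (hθ0 x hx))
  have h2 : ∀ x ∈ Icc (0:ℝ) 1, S.u x t * S.θ x t ≠ 0 := fun x hx =>
    mul_ne_zero (hu0 x hx) (hθ0 x hx)
  unfold dissip
  fun_prop (disch := assumption)

lemma dissip_nonneg {x t : ℝ} (hx : x ∈ Icc (0:ℝ) 1) (ht : 0 ≤ t) : 0 ≤ S.dissip x t := by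
  have h1 := S.hu_pos x hx t ht
  have h2 := S.hθ_pos x hx t ht
  unfold dissip
  positivity

lemma V_nonneg {t : ℝ} (ht : 0 ≤ t) : 0 ≤ S.V t :=
  intervalIntegral.integral_nonneg zero_le_one fun _ hx => S.dissip_nonneg hx ht

lemma hasDerivAt_time {x t : ℝ} (hx : x ∈ Icc (0:ℝ) 1) (ht : 0 < t) :
    HasDerivAt (S.u x) (S.ut x t) t ∧ HasDerivAt (S.v x) (S.vt x t) t ∧
      HasDerivAt (S.θ x) (S.θt x t) t :=
  ⟨(S.hut x hx t ht.le).hasDerivAt (Ici_mem_nhds ht),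
    (S.hvt x hx t ht.le).hasDerivAt (Ici_mem_nhds ht),
    (S.hθt x hx t ht.le).hasDerivAt (Ici_mem_nhds ht)⟩

/-- The momentum equation tested with a differentiable function. -/
lemma integral_mul_vt {φ φ' : ℝ → ℝ}
    (hφ : ∀ x ∈ Icc (0:ℝ) 1, HasDerivWithinAt φ (φ' x) (Icc 0 1) x)
    (hφ' : ContinuousOn φ' (Icc 0 1)) {t : ℝ} (ht : 0 ≤ t) :
    ∫ x in (0:ℝ)..1, φ x * S.vt x t = -∫ x in (0:ℝ)..1, φ' x * S.stress x t := by
  obtain ⟨hu, hv, hθ, hvx, hvt, hθx, hθt, hu0, hθ0⟩ := S.continuousOn_slice ht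
  have hs := S.continuousOn_stress ht
  have hφc : ContinuousOn φ (Icc 0 1) := fun x hx => (hφ x hx).continuousWithinAt
  have h := integral_eq_sub_of_hasDerivWithinAt_unit
    (fun x hx => (hφ x hx).mul (S.momentum x hx t ht))
    (by unfold stress at hs; fun_prop) le_rfl zero_le_one le_rfl
  simp only [Pi.mul_apply, S.bc0 t ht, S.bc1 t ht, mul_zero, sub_zero] at h
  rw [integral_unit_add (by unfold stress at hs; fun_prop) (by fun_prop)] at h
  exact eq_neg_of_add_eq_zero_right h

/-- The energy equation tested with a differentiable function. -/
lemma integral_mul_θt {ψ ψ' : ℝ → ℝ}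
    (hψ : ∀ x ∈ Icc (0:ℝ) 1, HasDerivWithinAt ψ (ψ' x) (Icc 0 1) x)
    (hψ' : ContinuousOn ψ' (Icc 0 1)) {t : ℝ} (ht : 0 ≤ t) :
    ∫ x in (0:ℝ)..1, ψ x * S.θt x t = (∫ x in (0:ℝ)..1, ψ x * (S.vx x t * S.stress x t))
      - ∫ x in (0:ℝ)..1, ψ' x * (S.θ x t ^ S.β * S.θx x t / S.u x t) := by
  obtain ⟨hu, hv, hθ, hvx, hvt, hθx, hθt, hu0, hθ0⟩ := S.continuousOn_slice ht
  have hs := S.continuousOn_stress ht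
  have hr := S.continuousOn_rpow ht S.β
  have hψc : ContinuousOn ψ (Icc 0 1) := fun x hx => (hψ x hx).continuousWithinAt
  have h := integral_eq_sub_of_hasDerivWithinAt_unit
    (fun x hx => (hψ x hx).mul (S.energyEq x hx t ht))
    (by fun_prop (disch := assumption)) le_rfl zero_le_one le_rfl
  simp only [Pi.mul_apply, S.bcθ0 t ht, S.bcθ1 t ht, mul_zero, zero_div, sub_zero] at h
  rw [integral_unit_add (by fun_prop (disch := assumption))
    (by fun_prop (disch := assumption))] at h
  have h2 : ∫ x in (0:ℝ)..1, ψ x * (S.θt x t + S.θ x t * S.vx x t / S.u x t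
        - S.vx x t ^ 2 / S.u x t)
      = (∫ x in (0:ℝ)..1, ψ x * S.θt x t) - ∫ x in (0:ℝ)..1, ψ x * (S.vx x t * S.stress x t) := by
    rw [← integral_unit_sub (by fun_prop) (by fun_prop)]
    refine integral_unit_congr fun x hx => ?_
    simp only [stress]
    ring
  linarith

lemma integral_v {t : ℝ} (ht : 0 ≤ t) : ∫ x in (0:ℝ)..1, S.v x t = S.meanV := by
  obtain ⟨hu, hv, hθ, hvx, hvt, hθx, hθt, hu0, hθ0⟩ := S.continuousOn_cylinder
  refine eq_of_hasDerivAt_zero (continuousOn_integral_unit hv) (fun s hs => ?_) ht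
  refine HasDerivAt.congr_deriv (hasDerivAt_integral_param hv hvt
    (fun x hx r hr => (S.hasDerivAt_time hx hr).2.1)
    (right_mem_Icc.2 zero_le_one) hs) (Eq.symm ?_)
  have h := S.integral_mul_vt (φ := fun _ => 1) (φ' := fun _ => 0)
    (fun x _ => hasDerivWithinAt_const x _ 1) continuousOn_const hs.le
  simpa using h.symm

lemma hasDerivAt_meanθ {t : ℝ} (ht : 0 < t) :
    HasDerivAt S.meanθ (∫ x in (0:ℝ)..1, S.vx x t * S.stress x t) t := by
  obtain ⟨hu, hv, hθ, hvx, hvt, hθx, hθt, hu0, hθ0⟩ := S.continuousOn_cylinder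
  refine HasDerivAt.congr_deriv (hasDerivAt_integral_param hθ hθt
    (fun x hx r hr => (S.hasDerivAt_time hx hr).2.2)
    (right_mem_Icc.2 zero_le_one) ht) (Eq.symm ?_)
  have h := S.integral_mul_θt (ψ := fun _ => 1) (ψ' := fun _ => 0)
    (fun x _ => hasDerivWithinAt_const x _ 1) continuousOn_const ht.le
  simpa using h.symm

/-- Conservation of energy. -/
lemma integral_v_sq {t : ℝ} (ht : 0 ≤ t) :
    (∫ x in (0:ℝ)..1, S.v x t ^ 2) = 2 * (S.E₀ - S.meanθ t) := by
  obtain ⟨hu, hv, hθ, hvx, hvt, hθx, hθt, hu0, hθ0⟩ := S.continuousOn_cylinder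
  have hE : ∫ x in (0:ℝ)..1, (S.v x t ^ 2 / 2 + S.θ x t) = S.E₀ := by
    refine eq_of_hasDerivAt_zero (g := fun t => ∫ x in (0:ℝ)..1, (S.v x t ^ 2 / 2 + S.θ x t))
      (continuousOn_integral_unit (by fun_prop)) (fun s hs => ?_) ht
    refine HasDerivAt.congr_deriv (hasDerivAt_integral_param
      (F := fun x t => S.v x t ^ 2 / 2 + S.θ x t)
      (F' := fun x t => S.v x t * S.vt x t + 1 * S.θt x t) (by fun_prop) (by fun_prop)
      (fun x hx r hr => ?_) (right_mem_Icc.2 zero_le_one) hs) (Eq.symm ?_)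
    · obtain ⟨-, h1, h2⟩ := S.hasDerivAt_time hx hr
      refine HasDerivAt.congr_deriv (((h1.pow 2).div_const 2).add h2) (Eq.symm ?_)
      push_cast
      ring
    · obtain ⟨hu, hv, hθ, hvx, hvt, hθx, hθt, hu0, hθ0⟩ := S.continuousOn_slice (le_of_lt hs)
      have h1 := S.integral_mul_vt (fun x hx => S.hvx x hx s (le_of_lt hs)) hvx (le_of_lt hs)
      have h2 := S.integral_mul_θt (ψ := fun _ => 1) (ψ' := fun _ => 0)
        (fun x _ => hasDerivWithinAt_const x _ 1) continuousOn_const (le_of_lt hs)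
      rw [integral_unit_add (by fun_prop) (by fun_prop), h1, h2]
      simp
  obtain ⟨hu, hv, hθ, hvx, hvt, hθx, hθt, hu0, hθ0⟩ := S.continuousOn_slice ht
  rw [integral_unit_add (by fun_prop) hθ, intervalIntegral.integral_div] at hE
  unfold meanθ
  linarith

lemma hasDerivAt_slope {t : ℝ} (ht : 0 < t) :
    HasDerivAt S.slope (-12 * ∫ x in (0:ℝ)..1, S.stress x t) t := by
  obtain ⟨hu, hv, hθ, hvx, hvt, hθx, hθt, hu0, hθ0⟩ := S.continuousOn_cylinder
  refine HasDerivAt.congr_deriv ((hasDerivAt_integral_param (F := fun x t => (x - 1 / 2) * S.v x t)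
      (F' := fun x t => (x - 1 / 2) * S.vt x t) (by fun_prop) (by fun_prop)
      (fun x hx r hr => (S.hasDerivAt_time hx hr).2.1.const_mul _) (right_mem_Icc.2 zero_le_one)
      ht).const_mul 12) (Eq.symm ?_)
  rw [S.integral_mul_vt (φ := fun x => x - 1 / 2) (φ' := fun _ => 1)
    (fun x _ => (hasDerivWithinAt_id x _).sub_const _) continuousOn_const ht.le]
  simp

/-- The entropy identity: the dissipation is an exact time derivative. -/
lemma hasDerivAt_entropy {t : ℝ} (ht : 0 < t) : HasDerivAt S.entropy (S.V t) t := by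
  have hlog : HasDerivAt (fun t => ∫ x in (0:ℝ)..1, Real.log (S.θ x t))
      (∫ x in (0:ℝ)..1, (S.θ x t)⁻¹ * S.θt x t) t := by
    obtain ⟨hu, hv, hθ, hvx, hvt, hθx, hθt, hu0, hθ0⟩ := S.continuousOn_cylinder
    refine hasDerivAt_integral_param (F := fun x t => Real.log (S.θ x t))
      (F' := fun x t => (S.θ x t)⁻¹ * S.θt x t) (hθ.log hθ0) ((hθ.inv₀ hθ0).mul hθt)
      (fun x hx r hr => ?_) (right_mem_Icc.2 zero_le_one) ht
    refine HasDerivAt.congr_deriv ((S.hasDerivAt_time hx hr).2.2.log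
      (hθ0 (x, r) ⟨hx, mem_Ici.2 (le_of_lt hr)⟩)) (Eq.symm ?_)
    ring
  refine HasDerivAt.congr_deriv (hlog.add ((S.hasDerivAt_slope ht).div_const 12)) (Eq.symm ?_)
  obtain ⟨hu, hv, hθ, hvx, hvt, hθx, hθt, hu0, hθ0⟩ := S.continuousOn_slice ht.le
  have hs := S.continuousOn_stress ht.le
  have hr := S.continuousOn_rpow ht.le S.β
  have hθ2 : ∀ x ∈ Icc (0:ℝ) 1, S.θ x t ^ 2 ≠ 0 := fun x hx => pow_ne_zero 2 (hθ0 x hx)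
  rw [S.integral_mul_θt (ψ := fun x => (S.θ x t)⁻¹) (ψ' := fun x => -S.θx x t / S.θ x t ^ 2)
    (fun x hx => (S.hθx x hx t ht.le).inv (hθ0 x hx)) (by fun_prop (disch := assumption)) ht.le,
    mul_div_right_comm, ← intervalIntegral.integral_const_mul,
    ← integral_unit_sub (by fun_prop (disch := assumption)) (by fun_prop (disch := assumption)),
    ← integral_unit_add (by fun_prop (disch := assumption)) (by fun_prop (disch := assumption))]
  refine integral_unit_congr fun x hx => ?_
  have h1 := hu0 x hx
  have h2 := hθ0 x hx
  simp only [stress]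
  field_simp
  ring

lemma hasDerivAt_gap {t : ℝ} (ht : 0 < t) :
    HasDerivAt S.gap (-∫ x in (0:ℝ)..1, (S.vx x t - S.slope t) * S.stress x t) t := by
  refine HasDerivAt.congr_deriv (((S.hasDerivAt_meanθ ht).const_sub (S.E₀ - S.meanV ^ 2 / 2)).sub
    (((S.hasDerivAt_slope ht).pow 2).div_const 24)) (Eq.symm ?_)
  obtain ⟨hu, hv, hθ, hvx, hvt, hθx, hθt, hu0, hθ0⟩ := S.continuousOn_slice ht.le
  have hs := S.continuousOn_stress ht.le
  have h : ∫ x in (0:ℝ)..1, (S.vx x t - S.slope t) * S.stress x t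
      = (∫ x in (0:ℝ)..1, S.vx x t * S.stress x t)
        - S.slope t * ∫ x in (0:ℝ)..1, S.stress x t := by
    rw [← intervalIntegral.integral_const_mul, ← integral_unit_sub (by fun_prop) (by fun_prop)]
    exact integral_unit_congr fun x _ => by ring
  rw [h]
  push_cast
  ring

lemma hasDerivAt_phase {x t : ℝ} (hx : x ∈ Icc (0:ℝ) 1) (ht : 0 < t) :
    HasDerivAt (S.phase x) (S.stress x t) t := by
  obtain ⟨hu, hv, hθ, hvx, hvt, hθx, hθt, hu0, hθ0⟩ := S.continuousOn_cylinder
  refine HasDerivAt.congr_deriv (hasDerivAt_integral_param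
    (F := fun x t => S.v x t - S.meanV - S.A * (x - 1 / 2))
    (F' := S.vt) (by fun_prop) (by fun_prop)
    (fun x hx r hr => ((S.hasDerivAt_time hx hr).2.1.sub_const _).sub_const _) hx ht) (Eq.symm ?_)
  rw [integral_eq_sub_of_hasDerivWithinAt_unit (fun x hx => S.momentum x hx t ht.le)
    (S.continuousOn_slice ht.le).2.2.2.2.1 le_rfl hx.1 hx.2, S.bc0 t ht.le, sub_zero, stress]

lemma continuousOn_phase :
    ContinuousOn (fun p : ℝ × ℝ => S.phase p.1 p.2) (Icc 0 1 ×ˢ Ici 0) := by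
  obtain ⟨hu, hv, hθ, hvx, hvt, hθx, hθt, hu0, hθ0⟩ := S.continuousOn_cylinder
  exact continuousOn_integral_param (F := fun x t => S.v x t - S.meanV - S.A * (x - 1 / 2))
    (by fun_prop)

lemma continuousOn_vol :
    ContinuousOn (fun p : ℝ × ℝ => S.vol p.1 p.2) (Icc 0 1 ×ˢ Ici 0) := by
  obtain ⟨hu, hv, hθ, hvx, hvt, hθx, hθt, hu0, hθ0⟩ := S.continuousOn_cylinder
  have h := S.continuousOn_phase
  unfold vol
  fun_prop

lemma hasDerivAt_vol {x t : ℝ} (hx : x ∈ Icc (0:ℝ) 1) (ht : 0 < t) :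
    HasDerivAt (S.vol x) (S.θ x t * rexp (-S.phase x t) - S.vol x t) t := by
  refine HasDerivAt.congr_deriv ((S.hasDerivAt_time hx ht).1.mul
    (S.hasDerivAt_phase hx ht).neg.exp) (Eq.symm ?_)
  have h1 := (S.hu_pos x hx t ht.le).ne'
  have h2 := S.mass x hx t ht.le
  rw [eq_sub_of_add_eq h2, vol, stress, Pi.neg_apply]
  field_simp
  ring

lemma slope_eq_integral_vx {t : ℝ} (ht : 0 ≤ t) :
    S.slope t = ∫ x in (0:ℝ)..1, 6 * (x - x ^ 2) * S.vx x t := by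
  obtain ⟨hu, hv, hθ, hvx, hvt, hθx, hθt, hu0, hθ0⟩ := S.continuousOn_slice ht
  have h := integral_eq_sub_of_hasDerivWithinAt_unit
    (fun x hx => (((hasDerivWithinAt_id x _).sub ((hasDerivWithinAt_id x _).pow 2)).const_mul
      6).mul (S.hvx x hx t ht)) (by simp only [id]; fun_prop) le_rfl zero_le_one le_rfl
  simp at h
  have h2 : ∫ x in (0:ℝ)..1, (6 * (x - x ^ 2) * S.vx x t - 12 * ((x - 1 / 2) * S.v x t)) = 0 := by
    refine Eq.trans (integral_unit_congr fun x _ => ?_) h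
    ring
  rw [integral_unit_sub (by fun_prop) (by fun_prop), intervalIntegral.integral_const_mul] at h2
  exact (sub_eq_zero.1 h2).symm

lemma integral_residual_sq {t : ℝ} (ht : 0 ≤ t) :
    ∫ x in (0:ℝ)..1, S.residual x t ^ 2 = 2 * S.gap t := by
  obtain ⟨hu, hv, hθ, hvx, hvt, hθx, hθt, hu0, hθ0⟩ := S.continuousOn_slice ht
  have h1 : ∫ x in (0:ℝ)..1, S.residual x t ^ 2 = ∫ x in (0:ℝ)..1,
      (S.v x t ^ 2 - 2 * S.meanV * S.v x t - 2 * S.slope t * ((x - 1 / 2) * S.v x t)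
        + (S.meanV + S.slope t * (x - 1 / 2)) ^ 2) :=
    integral_unit_congr fun x _ => by unfold residual; ring
  have h2 : ∫ x in (0:ℝ)..1, (S.meanV + S.slope t * (x - 1 / 2)) ^ 2
      = S.meanV ^ 2 + S.slope t ^ 2 / 12 := by
    have h3 := integral_eq_sub_of_hasDerivWithinAt_unit
      (G := fun x => S.meanV ^ 2 * x + S.meanV * S.slope t * (x ^ 2 - x)
        + S.slope t ^ 2 * (x - 1 / 2) ^ 3 / 3)
      (G' := fun x => (S.meanV + S.slope t * (x - 1 / 2)) ^ 2)
      (fun x hx => by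
        have hx := hasDerivWithinAt_id x (Icc (0:ℝ) 1)
        refine HasDerivWithinAt.congr_deriv (((hx.const_mul (S.meanV ^ 2)).add
          (((hx.pow 2).sub hx).const_mul
          (S.meanV * S.slope t))).add ((((hx.sub_const (1 / 2)).pow 3).const_mul
            (S.slope t ^ 2)).div_const 3)) (Eq.symm ?_)
        push_cast [id]
        ring)
      (by fun_prop) le_rfl zero_le_one le_rfl
    rw [h3]
    ring
  have h4 : ∫ x in (0:ℝ)..1, (x - 1 / 2) * S.v x t = S.slope t / 12 := by
    unfold slope
    ring
  rw [h1, integral_unit_add (by fun_prop) (by fun_prop),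
    integral_unit_sub (by fun_prop) (by fun_prop), integral_unit_sub (by fun_prop) (by fun_prop),
    intervalIntegral.integral_const_mul, intervalIntegral.integral_const_mul, h2, h4,
    S.integral_v ht, S.integral_v_sq ht, gap]
  ring

lemma meanθ_le {t : ℝ} (ht : 0 ≤ t) : S.meanθ t ≤ S.E₀ := by
  have h : 0 ≤ ∫ x in (0:ℝ)..1, S.v x t ^ 2 :=
    intervalIntegral.integral_nonneg zero_le_one fun _ _ => sq_nonneg _
  linarith [S.integral_v_sq ht]

lemma meanθ_pos {t : ℝ} (ht : 0 ≤ t) : 0 < S.meanθ t :=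
  intervalIntegral.intervalIntegral_pos_of_pos_on (integrable_unit (S.continuousOn_slice ht).2.2.1)
    (fun x hx => S.hθ_pos x ⟨hx.1.le, hx.2.le⟩ t ht) zero_lt_one

lemma E₀_pos : 0 < S.E₀ := (S.meanθ_pos le_rfl).trans_le (S.meanθ_le le_rfl)

lemma integral_abs_v_le {t : ℝ} (ht : 0 ≤ t) : ∫ x in (0:ℝ)..1, |S.v x t| ≤ S.E₀ + 1 / 2 := by
  have hv := (S.continuousOn_slice ht).2.1
  calc ∫ x in (0:ℝ)..1, |S.v x t| ≤ ∫ x in (0:ℝ)..1, (S.v x t ^ 2 / 2 + 1 / 2) :=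
        integral_unit_mono hv.abs (by fun_prop) fun x _ => by
          nlinarith [sq_nonneg (|S.v x t| - 1), sq_abs (S.v x t)]
    _ = S.E₀ - S.meanθ t + 1 / 2 := by
        rw [integral_unit_add (by fun_prop) (by fun_prop), intervalIntegral.integral_div,
          S.integral_v_sq ht, intervalIntegral.integral_const, smul_eq_mul]
        ring
    _ ≤ S.E₀ + 1 / 2 := by linarith [S.meanθ_pos ht]

lemma abs_slope_le {t : ℝ} (ht : 0 ≤ t) : |S.slope t| ≤ 6 * S.E₀ + 3 := by
  have hv := (S.continuousOn_slice ht).2.1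
  have h := abs_integral_sub_le (f := fun x => (x - 1 / 2) * S.v x t)
    (g := fun x => 1 / 2 * |S.v x t|) (by fun_prop) (by fun_prop)
    (fun x hx => by
      rw [abs_mul]
      exact mul_le_mul_of_nonneg_right (abs_le.2 ⟨by linarith [hx.1], by linarith [hx.2]⟩)
        (abs_nonneg _))
    (left_mem_Icc.2 zero_le_one) (right_mem_Icc.2 zero_le_one) zero_le_one
  rw [intervalIntegral.integral_const_mul] at h
  rw [slope, abs_mul, abs_of_pos (by norm_num : (0:ℝ) < 12)]
  linarith [S.integral_abs_v_le ht]

lemma exists_abs_phase_le : ∃ C, ∀ x ∈ Icc (0:ℝ) 1, ∀ t ≥ 0, |S.phase x t| ≤ C := by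
  refine ⟨S.E₀ + 1 / 2 + (|S.meanV| + |S.A|), fun x hx t ht => ?_⟩
  have hv := (S.continuousOn_slice ht).2.1
  have h := abs_integral_sub_le (f := fun y => S.v y t - S.meanV - S.A * (y - 1 / 2))
    (g := fun y => |S.v y t| + (|S.meanV| + |S.A|)) (by fun_prop) (by fun_prop)
    (fun y hy => by
      have h1 : |S.A * (y - 1 / 2)| ≤ |S.A| * 1 := by
        rw [abs_mul]
        exact mul_le_mul_of_nonneg_left (abs_le.2 ⟨by linarith [hy.1], by linarith [hy.2]⟩)
          (abs_nonneg _)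
      linarith [abs_sub (S.v y t - S.meanV) (S.A * (y - 1 / 2)), abs_sub (S.v y t) S.meanV])
    (left_mem_Icc.2 zero_le_one) hx hx.1
  rw [integral_unit_add (by fun_prop) (by fun_prop), intervalIntegral.integral_const] at h
  have h2 := S.integral_abs_v_le ht
  simp only [smul_eq_mul] at h
  unfold phase
  linarith

/-- Jensen's inequality for the logarithm. -/
lemma integral_log_le {t : ℝ} (ht : 0 ≤ t) :
    ∫ x in (0:ℝ)..1, Real.log (S.θ x t) ≤ Real.log (S.meanθ t) := by
  obtain ⟨hu, hv, hθ, hvx, hvt, hθx, hθt, hu0, hθ0⟩ := S.continuousOn_slice ht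
  have hm := S.meanθ_pos ht
  calc ∫ x in (0:ℝ)..1, Real.log (S.θ x t)
      ≤ ∫ x in (0:ℝ)..1, (S.θ x t / S.meanθ t + (Real.log (S.meanθ t) - 1)) :=
        integral_unit_mono (hθ.log hθ0) (by fun_prop) fun x hx => by
          have hp := S.hθ_pos x hx t ht
          have h1 := Real.log_le_sub_one_of_pos (div_pos hp hm)
          rw [Real.log_div hp.ne' hm.ne'] at h1
          linarith
    _ = Real.log (S.meanθ t) := by
        rw [integral_unit_add (by fun_prop) (by fun_prop), intervalIntegral.integral_div,
          intervalIntegral.integral_const, ← meanθ, div_self hm.ne', smul_eq_mul]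
        ring

lemma entropy_monotoneOn : MonotoneOn S.entropy (Ici 1) := by
  have h0 : ∀ t ≥ (1:ℝ), (0:ℝ) < t := fun t ht => zero_lt_one.trans_le ht
  refine monotoneOn_of_deriv_nonneg (convex_Ici 1)
    (fun s hs => (S.hasDerivAt_entropy (h0 s hs)).continuousAt.continuousWithinAt)
    (fun s hs => ?_) (fun s hs => ?_)
  all_goals rw [interior_Ici] at hs
  · exact (S.hasDerivAt_entropy (h0 s (le_of_lt hs))).differentiableAt.differentiableWithinAt
  · rw [(S.hasDerivAt_entropy (h0 s (le_of_lt hs))).deriv]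
    exact S.V_nonneg (h0 s (le_of_lt hs)).le

lemma exists_entropy_le : ∃ C, ∀ t ≥ 1, S.entropy t ≤ C := by
  refine ⟨Real.log S.E₀ + (6 * S.E₀ + 3) / 12, fun t ht => ?_⟩
  have h0 : 0 ≤ t := zero_le_one.trans ht
  have h1 := Real.log_le_log (S.meanθ_pos h0) (S.meanθ_le h0)
  have h2 := S.integral_log_le h0
  have h3 := (abs_le.1 (S.abs_slope_le h0)).2
  unfold entropy
  linarith

lemma exists_tendsto_entropy : ∃ l, Tendsto S.entropy atTop (𝓝 l) := by
  obtain ⟨C, hC⟩ := S.exists_entropy_le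
  have hmono : Monotone fun t => S.entropy (max 1 t) := fun a b hab =>
    S.entropy_monotoneOn (mem_Ici.2 (le_max_left _ _)) (mem_Ici.2 (le_max_left _ _))
      (max_le_max le_rfl hab)
  refine ⟨_, (tendsto_atTop_ciSup hmono ⟨C, ?_⟩).congr' ?_⟩
  · rintro _ ⟨t, rfl⟩
    exact hC _ (le_max_left _ _)
  · filter_upwards [eventually_ge_atTop 1] with t ht
    rw [max_eq_right ht]

lemma exists_le_meanθ : ∃ c > 0, ∀ t ≥ 1, c ≤ S.meanθ t := by
  refine ⟨rexp (S.entropy 1 - (6 * S.E₀ + 3) / 12), exp_pos _, fun t ht => ?_⟩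
  have h0 : 0 ≤ t := zero_le_one.trans ht
  rw [← Real.le_log_iff_exp_le (S.meanθ_pos h0)]
  have h1 := S.entropy_monotoneOn self_mem_Ici ht ht
  have h2 := S.integral_log_le h0
  have h3 := (abs_le.1 (S.abs_slope_le h0)).2
  have h4 : S.entropy t = (∫ x in (0:ℝ)..1, Real.log (S.θ x t)) + S.slope t / 12 := rfl
  linarith

/-- The oscillation of the temperature is controlled by the dissipation. -/
lemma exists_max_osc {t c U : ℝ} (ht : 0 ≤ t) (hc : 0 < c) (hcθ : c ≤ S.meanθ t)
    (hU : ∀ x ∈ Icc (0:ℝ) 1, S.u x t ≤ U) :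
    ∃ M, (∀ x ∈ Icc (0:ℝ) 1, S.θ x t ≤ M) ∧ ∀ y ∈ Icc (0:ℝ) 1, ∀ η > 0,
      c ^ (S.β / 2) * (M - S.θ y t)
        ≤ (1 + S.β / 2) * (η * S.E₀ * M + S.V t * U / (4 * η)) := by
  obtain ⟨hu, hv, hθ, hvx, hvt, hθx, hθt, hu0, hθ0⟩ := S.continuousOn_slice ht
  have hr := S.continuousOn_rpow ht (S.β / 2)
  have hdis := S.continuousOn_dissip ht
  have hβ := S.hβ
  obtain ⟨z, hz, hmax⟩ := isCompact_Icc.exists_isMaxOn (nonempty_Icc.2 zero_le_one) hθ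
  have hMpos := S.hθ_pos z hz t ht
  have hle : ∀ x ∈ Icc (0:ℝ) 1, S.θ x t ≤ S.θ z t := fun x hx => hmax hx
  have hcM : c ≤ S.θ z t := hcθ.trans <| by
    have h := integral_unit_mono hθ continuousOn_const hle
    simpa [meanθ] using h
  refine ⟨S.θ z t, hle, fun y hy η hη => ?_⟩
  have hypos := S.hθ_pos y hy t ht
  have hderiv : ∀ x ∈ Icc (0:ℝ) 1, HasDerivWithinAt (fun x => S.θ x t ^ (1 + S.β / 2))
      (S.θx x t * (1 + S.β / 2) * S.θ x t ^ (S.β / 2)) (Icc 0 1) x := fun x hx => by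
    have h := (S.hθx x hx t ht).rpow_const (p := 1 + S.β / 2) (Or.inl (hθ0 x hx))
    rwa [add_sub_cancel_left] at h
  have hcont : ContinuousOn (fun x => S.θx x t * (1 + S.β / 2) * S.θ x t ^ (S.β / 2))
      (Icc 0 1) := by fun_prop
  have hbound : ∀ x ∈ Icc (0:ℝ) 1, |S.θx x t * (1 + S.β / 2) * S.θ x t ^ (S.β / 2)|
      ≤ (1 + S.β / 2) * (η * S.θ z t * S.θ x t + U / (4 * η) * S.dissip x t) := fun x hx => by
    have hup := S.hu_pos x hx t ht
    have hp := S.hθ_pos x hx t ht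
    have ha : 0 < S.θ x t ^ (S.β / 2) := rpow_pos_of_pos hp _
    have ha2 : S.θ x t ^ S.β = (S.θ x t ^ (S.β / 2)) ^ 2 := by
      rw [← Real.rpow_natCast, ← Real.rpow_mul hp.le]
      norm_num
    set a := S.θ x t ^ (S.β / 2) with hadef
    have h1 : |S.θx x t| * a ≤ η * S.θ x t ^ 2
        + 1 / (4 * η) * (a ^ 2 * S.θx x t ^ 2 / S.θ x t ^ 2) := by
      have h2 : η * S.θ x t ^ 2 + 1 / (4 * η) * (a ^ 2 * S.θx x t ^ 2 / S.θ x t ^ 2)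
          - |S.θx x t| * a = (2 * η * S.θ x t ^ 2 - |S.θx x t| * a) ^ 2
            / (4 * η * S.θ x t ^ 2) := by
        rw [← sq_abs (S.θx x t)]
        field_simp
        ring
      have h3 : 0 ≤ (2 * η * S.θ x t ^ 2 - |S.θx x t| * a) ^ 2 / (4 * η * S.θ x t ^ 2) := by
        positivity
      linarith
    have h4 : η * S.θ x t ^ 2 ≤ η * S.θ z t * S.θ x t := by
      rw [mul_assoc, sq]
      exact mul_le_mul_of_nonneg_left (mul_le_mul_of_nonneg_right (hle x hx) hp.le) hη.le
    have h5 : 1 / (4 * η) * (a ^ 2 * S.θx x t ^ 2 / S.θ x t ^ 2)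
        ≤ U / (4 * η) * S.dissip x t := by
      have h6 : a ^ 2 * S.θx x t ^ 2 / (S.u x t * S.θ x t ^ 2) ≤ S.dissip x t := by
        rw [dissip, ha2]
        exact le_add_of_nonneg_right (by positivity)
      have h7 : a ^ 2 * S.θx x t ^ 2 / S.θ x t ^ 2
          = S.u x t * (a ^ 2 * S.θx x t ^ 2 / (S.u x t * S.θ x t ^ 2)) := by
        field_simp
      rw [h7, div_mul_eq_mul_div, div_mul_eq_mul_div, one_mul]
      exact div_le_div_of_nonneg_right (mul_le_mul (hU x hx) h6 (by positivity)
        (hup.le.trans (hU x hx))) (by positivity)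
    rw [abs_mul, abs_mul, abs_of_pos ha, abs_of_pos (by linarith : 0 < 1 + S.β / 2)]
    calc |S.θx x t| * (1 + S.β / 2) * a = (1 + S.β / 2) * (|S.θx x t| * a) := by ring
      _ ≤ _ := mul_le_mul_of_nonneg_left (by linarith) (by linarith)
  have hint : ∫ x in (0:ℝ)..1,
      (1 + S.β / 2) * (η * S.θ z t * S.θ x t + U / (4 * η) * S.dissip x t)
      = (1 + S.β / 2) * (η * S.θ z t * S.meanθ t + U / (4 * η) * S.V t) := by
    rw [intervalIntegral.integral_const_mul, integral_unit_add (by fun_prop) (by fun_prop),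
      intervalIntegral.integral_const_mul, intervalIntegral.integral_const_mul]
    rfl
  have hosc : S.θ z t ^ (1 + S.β / 2) - S.θ y t ^ (1 + S.β / 2)
      ≤ (1 + S.β / 2) * (η * S.θ z t * S.meanθ t + U / (4 * η) * S.V t) := by
    rw [← hint]
    rcases le_total y z with h | h
    · have h1 := abs_integral_sub_le hcont (by fun_prop) hbound hy hz h
      rw [integral_eq_sub_of_hasDerivWithinAt_unit hderiv hcont hy.1 h hz.2] at h1
      exact (le_abs_self _).trans h1
    · have h1 := abs_integral_sub_le hcont (by fun_prop) hbound hz hy h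
      rw [integral_eq_sub_of_hasDerivWithinAt_unit hderiv hcont hz.1 h hy.2, abs_sub_comm] at h1
      exact (le_abs_self _).trans h1
  have hlow : c ^ (S.β / 2) * (S.θ z t - S.θ y t)
      ≤ S.θ z t ^ (1 + S.β / 2) - S.θ y t ^ (1 + S.β / 2) := by
    rw [rpow_add hMpos, rpow_add hypos, rpow_one, rpow_one]
    have h1 : c ^ (S.β / 2) ≤ S.θ z t ^ (S.β / 2) := rpow_le_rpow hc.le hcM (by linarith)
    have h2 : S.θ y t ^ (S.β / 2) ≤ S.θ z t ^ (S.β / 2) :=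
      rpow_le_rpow hypos.le (hle y hy) (by linarith)
    have h3 := mul_le_mul_of_nonneg_right h1 (sub_nonneg.2 (hle y hy))
    have h4 := mul_le_mul_of_nonneg_left h2 hypos.le
    linarith
  refine hlow.trans (hosc.trans (mul_le_mul_of_nonneg_left ?_ (by linarith)))
  have h1 : η * S.θ z t * S.meanθ t ≤ η * S.E₀ * S.θ z t := by
    have := mul_le_mul_of_nonneg_left (S.meanθ_le ht) (mul_pos hη hMpos).le
    linarith
  have h2 : U / (4 * η) * S.V t = S.V t * U / (4 * η) := by ring
  linarith

lemma u_eq (x t : ℝ) : S.u x t = S.vol x t * rexp (S.phase x t) := by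
  rw [vol, mul_assoc, ← Real.exp_add, neg_add_cancel, Real.exp_zero, mul_one]

lemma vol_nonneg {x t : ℝ} (hx : x ∈ Icc (0:ℝ) 1) (ht : 0 ≤ t) : 0 ≤ S.vol x t :=
  (mul_pos (S.hu_pos x hx t ht) (exp_pos _)).le

lemma exists_θ_le_meanθ {t : ℝ} (ht : 0 ≤ t) : ∃ y ∈ Icc (0:ℝ) 1, S.θ y t ≤ S.meanθ t := by
  have hθ := (S.continuousOn_slice ht).2.2.1
  obtain ⟨y, hy, hmin⟩ := isCompact_Icc.exists_isMinOn (nonempty_Icc.2 zero_le_one) hθ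
  have h := integral_unit_mono continuousOn_const hθ fun x hx => hmin hx
  exact ⟨y, hy, by simpa [meanθ] using h⟩

lemma exists_max_bounds : ∃ K > 0, ∃ L > 0, ∀ t ≥ 1, ∀ U, (∀ x ∈ Icc (0:ℝ) 1, S.u x t ≤ U) →
    ∃ M, (∀ x ∈ Icc (0:ℝ) 1, S.θ x t ≤ M) ∧ M ≤ K * (1 + S.V t * U) ∧
      ∀ y ∈ Icc (0:ℝ) 1, ∀ η > 0,
        M - S.θ y t ≤ L * (η * (1 + S.V t * U) + S.V t * U / η) := by
  obtain ⟨c, hc, hcθ⟩ := S.exists_le_meanθ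
  have hE := S.E₀_pos
  have hβ := S.hβ
  set a := c ^ (S.β / 2) with ha_def
  set p := 1 + S.β / 2 with hp_def
  have ha : 0 < a := rpow_pos_of_pos hc _
  have hp : 0 < p := by positivity
  set K := 2 * S.E₀ + p ^ 2 * S.E₀ / a ^ 2 with hK_def
  have hK : 0 < K := by positivity
  refine ⟨K, hK, p / a * (S.E₀ * K + 1), by positivity, fun t ht U hU => ?_⟩
  have ht0 : 0 ≤ t := zero_le_one.trans ht
  have hUpos : 0 < U := (S.hu_pos 0 (left_mem_Icc.2 zero_le_one) t ht0).trans_le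
    (hU 0 (left_mem_Icc.2 zero_le_one))
  have hVU : 0 ≤ S.V t * U := mul_nonneg (S.V_nonneg ht0) hUpos.le
  obtain ⟨M, hM, hosc⟩ := S.exists_max_osc ht0 hc (hcθ t ht) hU
  have hMK : M ≤ K * (1 + S.V t * U) := by
    obtain ⟨y, hy, hyθ⟩ := S.exists_θ_le_meanθ ht0
    have h1 := hosc y hy (a / (2 * p * S.E₀)) (by positivity)
    have h2 : p * (a / (2 * p * S.E₀) * S.E₀ * M + S.V t * U / (4 * (a / (2 * p * S.E₀))))
        = a * (M / 2 + p ^ 2 * S.E₀ / a ^ 2 * (S.V t * U) / 2) := by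
      field_simp
      ring
    rw [h2] at h1
    have h3 := le_of_mul_le_mul_left h1 ha
    have h4 := S.meanθ_le ht0
    have h5 : 0 ≤ 2 * S.E₀ * (S.V t * U) := by positivity
    have h6 : 0 ≤ p ^ 2 * S.E₀ / a ^ 2 := by positivity
    rw [hK_def]
    linarith
  refine ⟨M, hM, hMK, fun y hy η hη => ?_⟩
  have h1 := hosc y hy η hη
  have h2 : η * S.E₀ * M + S.V t * U / (4 * η)
      ≤ (S.E₀ * K + 1) * (η * (1 + S.V t * U) + S.V t * U / η) := by
    have h3 : η * S.E₀ * M ≤ η * S.E₀ * (K * (1 + S.V t * U)) :=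
      mul_le_mul_of_nonneg_left hMK (by positivity)
    have h4 : S.V t * U / (4 * η) ≤ S.V t * U / η :=
      div_le_div_of_nonneg_left hVU hη (by linarith)
    have h5 : 0 ≤ S.V t * U / η := by positivity
    have h6 : 0 ≤ S.E₀ * K * (S.V t * U / η) := by positivity
    have h7 : 0 ≤ η * (1 + S.V t * U) := by positivity
    linarith
  have h8 : M - S.θ y t ≤ p * ((S.E₀ * K + 1) * (η * (1 + S.V t * U) + S.V t * U / η)) / a :=
    (le_div_iff₀' ha).2 (h1.trans (mul_le_mul_of_nonneg_left h2 hp.le))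
  refine h8.trans (le_of_eq ?_)
  ring

/-- A differentiable function below a barrier before time `t` cannot meet it with smaller slope. -/
lemma deriv_nonneg_of_first_touch {g : ℝ → ℝ} {g' a t : ℝ} (hat : a < t)
    (hg : HasDerivAt g g' t) (h0 : 0 ≤ g t) (hneg : ∀ s ∈ Ico a t, g s < 0) : 0 ≤ g' := by
  have h := (hasDerivAt_iff_tendsto_slope.1 hg).mono_left
    (nhdsWithin_mono t fun s (hs : s ∈ Iio t) => ne_of_lt hs)
  refine ge_of_tendsto h ?_
  filter_upwards [Ico_mem_nhdsLT hat] with s hs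
  rw [slope_def_field]
  exact div_nonneg_of_nonpos (by linarith [hneg s hs]) (by linarith [hs.2])

lemma exists_vol_le : ∃ N > 0, ∀ t ≥ 1, ∀ x ∈ Icc (0:ℝ) 1, S.vol x t ≤ N := by
  obtain ⟨P, hP⟩ := S.exists_abs_phase_le
  obtain ⟨K, hK, _, _, hKb⟩ := S.exists_max_bounds
  obtain ⟨m, hm⟩ := S.exists_entropy_le
  obtain ⟨z, hz, hmax⟩ := isCompact_Icc.exists_isMaxOn (nonempty_Icc.2 zero_le_one)
    (slice_continuousOn S.continuousOn_vol zero_le_one)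
  set Y := S.vol z 1 with hY
  have hYpos : 0 < Y := mul_pos (S.hu_pos z hz 1 (mem_Ici.2 zero_le_one)) (exp_pos _)
  set E := rexp P with hE_def
  have hE : 0 < E := exp_pos _
  set C := E ^ 2 * K with hC_def
  have hC : 0 < C := by positivity
  set N := (E * K + Y + 1) * rexp (-(C * S.entropy 1)) with hN_def
  have hN : 0 < N := by positivity
  set b : ℝ → ℝ := fun t => N * rexp (C * S.entropy t) with hb_def
  have hb1 : b 1 = E * K + Y + 1 := by
    simp only [hb_def, hN_def]
    rw [mul_assoc, ← Real.exp_add, neg_add_cancel, Real.exp_zero, mul_one]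
  have hbd : ∀ t ≥ 1, HasDerivAt b (C * S.V t * b t) t := fun t ht => by
    refine ((((S.hasDerivAt_entropy (zero_lt_one.trans_le ht)).const_mul C).exp).const_mul
      N).congr_deriv ?_
    simp only [hb_def]
    ring
  have hbmono : ∀ t ≥ 1, b 1 ≤ b t := fun t ht => by
    have := S.entropy_monotoneOn self_mem_Ici ht ht
    simp only [hb_def]
    gcongr
  have hvb : ∀ t ≥ 1, ∀ x ∈ Icc (0:ℝ) 1, S.vol x t ≤ b t := by
    by_contra! hcon
    obtain ⟨t₁, ht₁, x₁, hx₁, hlt⟩ := hcon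
    have hsub : Icc (0:ℝ) 1 ×ˢ Icc 1 t₁ ⊆ Icc 0 1 ×ˢ Ici 0 :=
      prod_mono_right fun s hs => zero_le_one.trans hs.1
    have hgc : ContinuousOn (fun p : ℝ × ℝ => S.vol p.1 p.2 - b p.2) (Icc 0 1 ×ˢ Icc 1 t₁) :=
      (S.continuousOn_vol.mono hsub).sub fun p hp =>
        ((hbd p.2 hp.2.1).continuousAt.comp continuousAt_snd).continuousWithinAt
    have hcompact : IsCompact ((Icc (0:ℝ) 1 ×ˢ Icc 1 t₁) ∩
        (fun p : ℝ × ℝ => S.vol p.1 p.2 - b p.2) ⁻¹' Ici 0) :=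
      (isCompact_Icc.prod isCompact_Icc).of_isClosed_subset
        (hgc.preimage_isClosed_of_isClosed (isClosed_Icc.prod isClosed_Icc) isClosed_Ici)
        inter_subset_left
    obtain ⟨⟨x₀, t₀⟩, ⟨⟨hx₀, ht₀⟩, htouch⟩, hfirst⟩ := hcompact.exists_isMinOn
      ⟨(x₁, t₁), ⟨hx₁, ht₁, le_rfl⟩, mem_Ici.2 (sub_nonneg.2 hlt.le)⟩
      continuous_snd.continuousOn
    simp only at hx₀ ht₀
    have htouch' : 0 ≤ S.vol x₀ t₀ - b t₀ := htouch
    have hbelow : ∀ s ∈ Ico 1 t₀, ∀ x ∈ Icc (0:ℝ) 1, S.vol x s - b s < 0 := fun s hs x hx => by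
      by_contra! h
      have := hfirst (a := (x, s)) ⟨⟨hx, hs.1, hs.2.le.trans ht₀.2⟩, h⟩
      exact absurd this (not_le.2 hs.2)
    have ht₀1 : 1 < t₀ := by
      refine lt_of_le_of_ne ht₀.1 fun h => ?_
      have h1 : S.vol x₀ 1 ≤ Y := hmax hx₀
      rw [← h, hb1] at htouch'
      linarith [mul_pos hE hK]
    have ht₀0 : 0 < t₀ := zero_lt_one.trans ht₀1
    have hgd : ∀ x ∈ Icc (0:ℝ) 1, HasDerivAt (fun s => S.vol x s - b s)
        (S.θ x t₀ * rexp (-S.phase x t₀) - S.vol x t₀ - C * S.V t₀ * b t₀) t₀ := fun x hx =>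
      (S.hasDerivAt_vol hx ht₀0).sub (hbd t₀ ht₀1.le)
    have hle : ∀ x ∈ Icc (0:ℝ) 1, S.vol x t₀ - b t₀ ≤ 0 := fun x hx =>
      le_of_tendsto ((hgd x hx).continuousAt.tendsto.mono_left nhdsWithin_le_nhds)
        (by filter_upwards [Ico_mem_nhdsLT ht₀1] with s hs using (hbelow s hs x hx).le)
    have hnn := deriv_nonneg_of_first_touch ht₀1 (hgd x₀ hx₀) htouch'
      fun s hs => hbelow s hs x₀ hx₀
    have hu : ∀ x ∈ Icc (0:ℝ) 1, S.u x t₀ ≤ E * b t₀ := fun x hx => by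
      have h2 : S.vol x t₀ ≤ b t₀ := sub_nonpos.1 (hle x hx)
      have h3 := S.vol_nonneg hx ht₀0.le
      rw [u_eq, mul_comm]
      exact mul_le_mul (exp_le_exp.2 (abs_le.1 (hP x hx t₀ ht₀0.le)).2) h2 h3 hE.le
    obtain ⟨M, hM, hMK, -⟩ := hKb t₀ ht₀1.le _ hu
    have h1 : S.θ x₀ t₀ * rexp (-S.phase x₀ t₀) ≤ K * (1 + S.V t₀ * (E * b t₀)) * E :=
      mul_le_mul ((hM x₀ hx₀).trans hMK)
        (exp_le_exp.2 (by linarith [(abs_le.1 (hP x₀ hx₀ t₀ ht₀0.le)).1])) (exp_pos _).le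
        ((S.hθ_pos x₀ hx₀ t₀ ht₀0.le).le.trans ((hM x₀ hx₀).trans hMK))
    have h2 := hbmono t₀ ht₀1.le
    rw [hb1] at h2
    have h3 : K * (1 + S.V t₀ * (E * b t₀)) * E = E * K + C * S.V t₀ * b t₀ := by
      rw [hC_def]
      ring
    linarith
  refine ⟨N * rexp (C * m), by positivity, fun t ht x hx => (hvb t ht x hx).trans ?_⟩
  have := hm t ht
  simp only [hb_def]
  gcongr

lemma exists_u_le : ∃ U > 0, ∀ t ≥ 1, ∀ x ∈ Icc (0:ℝ) 1, S.u x t ≤ U := by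
  obtain ⟨P, hP⟩ := S.exists_abs_phase_le
  obtain ⟨N, hN, hvol⟩ := S.exists_vol_le
  refine ⟨N * rexp P, by positivity, fun t ht x hx => ?_⟩
  have ht0 : 0 ≤ t := zero_le_one.trans ht
  rw [u_eq]
  exact mul_le_mul (hvol t ht x hx) (exp_le_exp.2 (abs_le.1 (hP x hx t ht0)).2) (exp_pos _).le
    hN.le

lemma exists_abs_θ_sub_meanθ_le {ε : ℝ} (hε : 0 < ε) :
    ∃ C, ∀ t ≥ 1, ∀ x ∈ Icc (0:ℝ) 1, |S.θ x t - S.meanθ t| ≤ ε + C * S.V t := by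
  obtain ⟨U, hU, hu⟩ := S.exists_u_le
  obtain ⟨_, _, L, hL, hb⟩ := S.exists_max_bounds
  refine ⟨ε * U + L ^ 2 * U / ε, fun t ht x hx => ?_⟩
  have hθ := (S.continuousOn_slice (zero_le_one.trans ht)).2.2.1
  obtain ⟨M, hM, -, hosc⟩ := hb t ht U (hu t ht)
  have hD : ∀ y ∈ Icc (0:ℝ) 1, M - S.θ y t ≤ ε + (ε * U + L ^ 2 * U / ε) * S.V t := fun y hy => by
    refine (hosc y hy (ε / L) (by positivity)).trans (le_of_eq ?_)
    field_simp
    ring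
  have h1 := integral_unit_mono hθ continuousOn_const hM
  have h2 := integral_unit_mono (by fun_prop) continuousOn_const hD
  rw [integral_unit_sub continuousOn_const hθ] at h2
  simp only [intervalIntegral.integral_const, sub_zero, smul_eq_mul, one_mul] at h1 h2
  have h3 := hD x hx
  have h4 := hM x hx
  unfold meanθ
  exact abs_le.2 ⟨by linarith, by linarith⟩

/-- `q` is bounded above, up to arbitrarily small constants, by multiples of the integrable
function `V`. -/
def Negligible (q : ℝ → ℝ) : Prop := ∀ ε > 0, ∃ C, ∀ᶠ t in atTop, q t ≤ ε + C * S.V t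

namespace Negligible

variable {S} {p q : ℝ → ℝ}

lemma of_forall_le_mul {K : ℝ} (hK : 0 < K)
    (h : ∀ δ > 0, ∃ C, ∀ᶠ t in atTop, q t ≤ K * δ + C * S.V t) : S.Negligible q := fun ε hε => by
  obtain ⟨C, hC⟩ := h (ε / K) (div_pos hε hK)
  exact ⟨C, by rwa [mul_div_cancel₀ _ hK.ne'] at hC⟩

lemma mono (hq : S.Negligible q) (h : ∀ᶠ t in atTop, p t ≤ q t) : S.Negligible p := fun ε hε => by
  obtain ⟨C, hC⟩ := hq ε hε
  exact ⟨C, by filter_upwards [h, hC] with t h1 h2 using h1.trans h2⟩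

lemma add (hp : S.Negligible p) (hq : S.Negligible q) : S.Negligible fun t => p t + q t :=
  of_forall_le_mul two_pos fun δ hδ => by
    obtain ⟨C, hC⟩ := hp δ hδ
    obtain ⟨D, hD⟩ := hq δ hδ
    refine ⟨C + D, ?_⟩
    filter_upwards [hC, hD] with t h1 h2
    linarith

lemma const_mul (hq : S.Negligible q) {c : ℝ} (hc : 0 < c) : S.Negligible fun t => c * q t :=
  of_forall_le_mul hc fun δ hδ => by
    obtain ⟨C, hC⟩ := hq δ hδ
    refine ⟨c * C, ?_⟩
    filter_upwards [hC] with t h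
    linarith [mul_le_mul_of_nonneg_left h hc.le]

lemma tendsto_zero {y y' : ℝ → ℝ} {Y : ℝ} (hn : S.Negligible fun t => y' t + y t)
    (hd : ∀ t > 0, HasDerivAt y (y' t) t) (h0 : ∀ t ≥ 0, 0 ≤ y t) (hY : ∀ t ≥ 0, y t ≤ Y) :
    Tendsto y atTop (𝓝 0) := by
  obtain ⟨l, hl⟩ := S.exists_tendsto_entropy
  rw [Metric.tendsto_atTop]
  intro ε hε
  obtain ⟨C, hC⟩ := hn (ε / 5) (by positivity)
  obtain ⟨T, hT⟩ := eventually_atTop.1 (hC.and (eventually_ge_atTop 1))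
  have hT1 : 1 ≤ T := (hT T le_rfl).2
  obtain ⟨T', hTT', h⟩ := eventually_le_of_damped (fun t ht => S.hasDerivAt_entropy ht) hl C T Y
    (ε := ε / 5) (by positivity)
  refine ⟨T', fun t ht => ?_⟩
  have h1 := h y y' (fun s hs => hd s (by linarith)) (fun s hs => (hT s hs).1)
    (fun s hs => hY s (by linarith)) t ht
  rw [Real.dist_0_eq_abs, abs_of_nonneg (h0 t (by linarith))]
  linarith

end Negligible

lemma exists_le_u : ∃ c > 0, ∀ᶠ t in atTop, ∀ x ∈ Icc (0:ℝ) 1, c ≤ S.u x t := by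
  obtain ⟨P, hP⟩ := S.exists_abs_phase_le
  obtain ⟨c, hc, hcθ⟩ := S.exists_le_meanθ
  obtain ⟨l, hl⟩ := S.exists_tendsto_entropy
  obtain ⟨D, hD⟩ := S.exists_abs_θ_sub_meanθ_le (ε := c / 8) (by positivity)
  set E := rexp (-P) with hE_def
  have hE : 0 < E := exp_pos _
  obtain ⟨T, hT, h⟩ := eventually_le_of_damped (fun t ht => S.hasDerivAt_entropy ht) hl
    (E * D) 1 (E * c) (ε := E * (c / 8)) (by positivity)
  refine ⟨E * c / 2 * E, by positivity, ?_⟩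
  filter_upwards [eventually_ge_atTop T] with t ht x hx
  have hvol : E * c / 2 ≤ S.vol x t := by
    have := h (fun s => E * c - S.vol x s)
      (fun s => -(S.θ x s * rexp (-S.phase x s) - S.vol x s))
      (fun s hs => (S.hasDerivAt_vol hx (by linarith)).const_sub _)
      (fun s hs => by
        have h1 := abs_le.1 (hD s hs x hx)
        have h2 := hcθ s hs
        have h3 : E ≤ rexp (-S.phase x s) :=
          exp_le_exp.2 (by linarith [(abs_le.1 (hP x hx s (by linarith))).2])
        have h4 := S.hθ_pos x hx s (by simp only [mem_Ici]; linarith)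
        have h5 : S.θ x s * E ≤ S.θ x s * rexp (-S.phase x s) :=
          mul_le_mul_of_nonneg_left h3 h4.le
        have h6 : E * (c - c / 8 - D * S.V s) ≤ E * S.θ x s :=
          mul_le_mul_of_nonneg_left (by linarith) hE.le
        linarith)
      (fun s hs => by linarith [S.vol_nonneg hx (show 0 ≤ s by linarith)]) t ht
    linarith
  rw [u_eq]
  have h3 : E ≤ rexp (S.phase x t) :=
    exp_le_exp.2 (by linarith [(abs_le.1 (hP x hx t (by linarith))).1])
  exact mul_le_mul hvol h3 hE.le (by linarith [mul_pos hE hc])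

lemma negligible_integral_abs_vx_sub_θ :
    S.Negligible fun t => ∫ x in (0:ℝ)..1, |S.vx x t - S.θ x t| := by
  obtain ⟨U, hU, hu⟩ := S.exists_u_le
  have hE := S.E₀_pos
  refine Negligible.of_forall_le_mul (K := U * S.E₀) (by positivity) fun δ hδ =>
    ⟨1 / (4 * δ), ?_⟩
  filter_upwards [eventually_ge_atTop 1] with t ht
  have ht0 : 0 ≤ t := zero_le_one.trans ht
  obtain ⟨-, -, hθ, hvx, -⟩ := S.continuousOn_slice ht0
  have hdis := S.continuousOn_dissip ht0
  calc ∫ x in (0:ℝ)..1, |S.vx x t - S.θ x t|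
      ≤ ∫ x in (0:ℝ)..1, (δ * U * S.θ x t + 1 / (4 * δ) * S.dissip x t) := by
        refine integral_unit_mono (by fun_prop) (by fun_prop) fun x hx => ?_
        have hup := S.hu_pos x hx t ht0
        have hθp := S.hθ_pos x hx t ht0
        have h1 : (S.vx x t - S.θ x t) ^ 2 / (S.u x t * S.θ x t) ≤ S.dissip x t := by
          unfold dissip
          have := S.hβ
          have : 0 ≤ S.θ x t ^ S.β * (S.θx x t) ^ 2 / (S.u x t * (S.θ x t) ^ 2) := by positivity
          linarith
        have h2 : δ * (S.u x t * S.θ x t) ≤ δ * U * S.θ x t := by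
          rw [mul_assoc]
          gcongr
          exact hu t ht x hx
        have h3 : |S.vx x t - S.θ x t| ≤ δ * (S.u x t * S.θ x t)
            + 1 / (4 * δ) * ((S.vx x t - S.θ x t) ^ 2 / (S.u x t * S.θ x t)) := by
          rw [← sq_abs (S.vx x t - S.θ x t)]
          set a := |S.vx x t - S.θ x t|
          have hr : 0 < S.u x t * S.θ x t := mul_pos hup hθp
          set r := S.u x t * S.θ x t
          have h4 : δ * r + 1 / (4 * δ) * (a ^ 2 / r) - a = (2 * δ * r - a) ^ 2 / (4 * δ * r) := by
            field_simp
            ring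
          have h5 : 0 ≤ (2 * δ * r - a) ^ 2 / (4 * δ * r) := by positivity
          linarith
        have h6 := mul_le_mul_of_nonneg_left h1 (show 0 ≤ 1 / (4 * δ) by positivity)
        linarith
    _ = δ * U * S.meanθ t + 1 / (4 * δ) * S.V t := by
        rw [integral_unit_add (by fun_prop) (by fun_prop), intervalIntegral.integral_const_mul,
          intervalIntegral.integral_const_mul]
        rfl
    _ ≤ U * S.E₀ * δ + 1 / (4 * δ) * S.V t := by
        have := mul_le_mul_of_nonneg_left (S.meanθ_le ht0) (show 0 ≤ δ * U by positivity)
        linarith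

lemma negligible_integral_abs_stress : S.Negligible fun t => ∫ x in (0:ℝ)..1, |S.stress x t| := by
  obtain ⟨c, hc, hcu⟩ := S.exists_le_u
  refine (S.negligible_integral_abs_vx_sub_θ.const_mul (inv_pos.2 hc)).mono ?_
  filter_upwards [hcu, eventually_ge_atTop 0] with t hct ht
  obtain ⟨-, -, hθ, hvx, -⟩ := S.continuousOn_slice ht
  have hs := S.continuousOn_stress ht
  rw [← intervalIntegral.integral_const_mul]
  refine integral_unit_mono hs.abs (by fun_prop) fun x hx => ?_
  rw [stress, abs_div, abs_of_pos (S.hu_pos x hx t ht), div_eq_inv_mul]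
  gcongr
  exact hct x hx

lemma negligible_integral_abs_θ_sub_meanθ :
    S.Negligible fun t => ∫ x in (0:ℝ)..1, |S.θ x t - S.meanθ t| := fun ε hε => by
  obtain ⟨C, hC⟩ := S.exists_abs_θ_sub_meanθ_le hε
  refine ⟨C, ?_⟩
  filter_upwards [eventually_ge_atTop 1] with t ht
  obtain ⟨-, -, hθ, -⟩ := S.continuousOn_slice (zero_le_one.trans ht)
  simpa using integral_unit_mono (g := fun _ => ε + C * S.V t)
    (hθ.sub continuousOn_const).abs continuousOn_const (hC t ht)

lemma negligible_abs_slope_sub_meanθ : S.Negligible fun t => |S.slope t - S.meanθ t| := by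
  refine ((S.negligible_integral_abs_vx_sub_θ.add
    S.negligible_integral_abs_θ_sub_meanθ).const_mul (show (0:ℝ) < 3 / 2 by norm_num)).mono ?_
  filter_upwards [eventually_ge_atTop 0] with t ht
  obtain ⟨-, -, hθ, hvx, -⟩ := S.continuousOn_slice ht
  have h1 : S.slope t - S.meanθ t
      = ∫ x in (0:ℝ)..1, 6 * (x - x ^ 2) * (S.vx x t - S.meanθ t) := by
    have h2 : ∫ x in (0:ℝ)..1, 6 * (x - x ^ 2) * S.meanθ t = S.meanθ t := by
      rw [intervalIntegral.integral_mul_const, intervalIntegral.integral_const_mul,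
        integral_unit_sub (by fun_prop) (by fun_prop), integral_id, integral_pow]
      norm_num
    simp only [mul_sub _ (S.vx _ t)]
    rw [integral_unit_sub (by fun_prop) (by fun_prop), h2, ← S.slope_eq_integral_vx ht]
  rw [h1, ← integral_unit_add (by fun_prop) (by fun_prop), ← intervalIntegral.integral_const_mul]
  refine abs_integral_sub_le (by fun_prop) (by fun_prop) (fun x hx => ?_)
    (left_mem_Icc.2 zero_le_one) (right_mem_Icc.2 zero_le_one) zero_le_one
  have h3 : |6 * (x - x ^ 2)| ≤ 3 / 2 :=
    abs_le.2 ⟨by nlinarith [hx.1, hx.2], by nlinarith [sq_nonneg (x - 1 / 2)]⟩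
  rw [abs_mul]
  refine mul_le_mul h3 ?_ (abs_nonneg _) (by norm_num)
  calc |S.vx x t - S.meanθ t| = |(S.vx x t - S.θ x t) + (S.θ x t - S.meanθ t)| := by ring_nf
    _ ≤ _ := abs_add_le _ _

lemma negligible_integral_θ_sub_slope_sq :
    S.Negligible fun t => ∫ x in (0:ℝ)..1, (S.θ x t - S.slope t) ^ 2 := by
  have hE := S.E₀_pos
  set B := S.E₀ + (6 * S.E₀ + 3) with hB_def
  have hB : 0 < B := by positivity
  refine Negligible.of_forall_le_mul (K := B * 2) (by positivity) fun δ hδ => ?_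
  obtain ⟨C, hC⟩ := S.exists_abs_θ_sub_meanθ_le hδ
  obtain ⟨D, hD⟩ := S.negligible_abs_slope_sub_meanθ δ hδ
  refine ⟨B * (C + D), ?_⟩
  filter_upwards [hD, eventually_ge_atTop 1] with t hDt ht
  have ht0 : 0 ≤ t := zero_le_one.trans ht
  obtain ⟨-, -, hθ, -⟩ := S.continuousOn_slice ht0
  have hsl := S.abs_slope_le ht0
  set R := 2 * δ + (C + D) * S.V t with hR_def
  have hdist : ∀ x ∈ Icc (0:ℝ) 1, |S.θ x t - S.slope t| ≤ R := fun x hx => by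
    have h1 := abs_le.1 (hC t ht x hx)
    have h2 := abs_le.1 hDt
    exact abs_le.2 ⟨by linarith, by linarith⟩
  have hR : 0 ≤ R := (abs_nonneg _).trans (hdist 0 (left_mem_Icc.2 zero_le_one))
  calc ∫ x in (0:ℝ)..1, (S.θ x t - S.slope t) ^ 2
      ≤ ∫ x in (0:ℝ)..1, R * (S.θ x t + (6 * S.E₀ + 3)) := by
        refine integral_unit_mono (by fun_prop) (by fun_prop) fun x hx => ?_
        rw [← sq_abs, sq]
        refine mul_le_mul (hdist x hx) ?_ (abs_nonneg _) hR
        have h1 := S.hθ_pos x hx t ht0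
        have h2 := abs_le.1 hsl
        exact abs_le.2 ⟨by linarith, by linarith⟩
    _ = R * (S.meanθ t + (6 * S.E₀ + 3)) := by
        rw [intervalIntegral.integral_const_mul, integral_unit_add hθ continuousOn_const]
        simp [meanθ]
    _ ≤ R * B := mul_le_mul_of_nonneg_left (by linarith [S.meanθ_le ht0]) hR
    _ = B * 2 * δ + B * (C + D) * S.V t := by
        rw [hR_def]
        ring

lemma gap_nonneg {t : ℝ} (ht : 0 ≤ t) : 0 ≤ S.gap t := by
  have h : 0 ≤ ∫ x in (0:ℝ)..1, S.residual x t ^ 2 :=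
    intervalIntegral.integral_nonneg zero_le_one fun _ _ => sq_nonneg _
  linarith [S.integral_residual_sq ht]

lemma gap_le {t : ℝ} (ht : 0 ≤ t) : S.gap t ≤ S.E₀ := by
  have := S.meanθ_pos ht
  unfold gap
  linarith [sq_nonneg S.meanV, sq_nonneg (S.slope t)]

lemma continuousOn_residual {t : ℝ} (ht : 0 ≤ t) :
    ContinuousOn (fun x => S.residual x t) (Icc 0 1) := by
  have hv := (S.continuousOn_slice ht).2.1
  unfold residual
  fun_prop

lemma integral_residual {t : ℝ} (ht : 0 ≤ t) : ∫ x in (0:ℝ)..1, S.residual x t = 0 := by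
  have hv := (S.continuousOn_slice ht).2.1
  unfold residual
  rw [integral_unit_sub (by fun_prop) (by fun_prop), integral_unit_sub hv continuousOn_const,
    S.integral_v ht, intervalIntegral.integral_const_mul,
    integral_unit_sub (by fun_prop) (by fun_prop), integral_id]
  norm_num

lemma abs_residual_le {x t : ℝ} (hx : x ∈ Icc (0:ℝ) 1) (ht : 0 ≤ t) :
    |S.residual x t| ≤ ∫ y in (0:ℝ)..1, |S.vx y t - S.slope t| := by
  have hvx := (S.continuousOn_slice ht).2.2.2.1
  have hr := S.continuousOn_residual ht
  set G := ∫ y in (0:ℝ)..1, |S.vx y t - S.slope t|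
  have hd : ∀ y ∈ Icc (0:ℝ) 1, HasDerivWithinAt (fun y => S.residual y t)
      (S.vx y t - S.slope t) (Icc 0 1) y := fun y hy => by
    refine HasDerivWithinAt.congr_deriv (((S.hvx y hy t ht).sub_const S.meanV).sub
      (((hasDerivWithinAt_id y _).sub_const (1 / 2)).const_mul (S.slope t))) (by ring)
  have hle : ∀ a ∈ Icc (0:ℝ) 1, ∀ b ∈ Icc (0:ℝ) 1, a ≤ b →
      |S.residual b t - S.residual a t| ≤ G := fun a ha b hb hab => by
    rw [← integral_eq_sub_of_hasDerivWithinAt_unit hd (by fun_prop) ha.1 hab hb.2]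
    exact abs_integral_sub_le (by fun_prop) (by fun_prop) (fun _ _ => le_rfl) ha hb hab
  have hG : ∀ y ∈ Icc (0:ℝ) 1, |S.residual y t - S.residual x t| ≤ G := fun y hy => by
    rcases le_total x y with h | h
    · exact hle x hx y hy h
    · rw [abs_sub_comm]
      exact hle y hy x hx h
  have h1 := integral_unit_mono (f := fun y => S.residual y t)
    (g := fun _ => S.residual x t + G) hr continuousOn_const
    fun y hy => by linarith [(abs_le.1 (hG y hy)).2]
  have h2 := integral_unit_mono (f := fun _ => S.residual x t - G)
    (g := fun y => S.residual y t) continuousOn_const hr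
    fun y hy => by linarith [(abs_le.1 (hG y hy)).1]
  rw [S.integral_residual ht] at h1 h2
  simp only [intervalIntegral.integral_const, sub_zero, one_smul] at h1 h2
  exact abs_le.2 ⟨by linarith, by linarith⟩

lemma negligible_gap : S.Negligible S.gap := by
  have hE := S.E₀_pos
  refine (((S.negligible_integral_abs_vx_sub_θ.add S.negligible_integral_abs_θ_sub_meanθ).add
    S.negligible_abs_slope_sub_meanθ).const_mul (c := 1 / 4 + S.E₀ / 2) (by positivity)).mono ?_
  filter_upwards [eventually_ge_atTop 0] with t ht
  obtain ⟨-, -, hθ, hvx, -⟩ := S.continuousOn_slice ht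
  have hr := S.continuousOn_residual ht
  have hG : ∫ x in (0:ℝ)..1, |S.vx x t - S.slope t|
      ≤ (∫ x in (0:ℝ)..1, |S.vx x t - S.θ x t|) + (∫ x in (0:ℝ)..1, |S.θ x t - S.meanθ t|)
        + |S.slope t - S.meanθ t| := by
    have h := integral_unit_mono (f := fun x => |S.vx x t - S.slope t|)
      (g := fun x => |S.vx x t - S.θ x t| + |S.θ x t - S.meanθ t| + |S.slope t - S.meanθ t|)
      (by fun_prop) (by fun_prop) fun x _ => by
        rw [abs_sub_comm (S.slope t)]
        calc |S.vx x t - S.slope t| = |(S.vx x t - S.θ x t) + (S.θ x t - S.meanθ t)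
              + (S.meanθ t - S.slope t)| := by ring_nf
          _ ≤ _ := abs_add_three _ _ _
    rw [integral_unit_add (by fun_prop) (by fun_prop),
      integral_unit_add (by fun_prop) (by fun_prop)] at h
    simpa using h
  set G := ∫ x in (0:ℝ)..1, |S.vx x t - S.slope t|
  have hG0 : 0 ≤ G := (abs_nonneg _).trans (S.abs_residual_le (left_mem_Icc.2 zero_le_one) ht)
  have h1 : ∫ x in (0:ℝ)..1, S.residual x t ^ 2
      ≤ ∫ x in (0:ℝ)..1, G / 2 * (1 + S.residual x t ^ 2) :=
    integral_unit_mono (by fun_prop) (by fun_prop) fun x hx => by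
      have h2 := S.abs_residual_le hx ht
      have h3 := mul_le_mul_of_nonneg_right h2 (abs_nonneg (S.residual x t))
      rw [← sq, sq_abs] at h3
      nlinarith [mul_nonneg hG0 (sq_nonneg (|S.residual x t| - 1)), sq_abs (S.residual x t)]
  rw [intervalIntegral.integral_const_mul, integral_unit_add continuousOn_const (by fun_prop),
    S.integral_residual_sq ht] at h1
  simp only [intervalIntegral.integral_const, sub_zero, one_smul] at h1
  have h4 := mul_le_mul_of_nonneg_left (S.gap_le ht) hG0
  have h5 := mul_le_mul_of_nonneg_left hG (show 0 ≤ 1 / 4 + S.E₀ / 2 by positivity)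
  nlinarith

lemma tendsto_gap : Tendsto S.gap atTop (𝓝 0) := by
  obtain ⟨c, hc, hcu⟩ := S.exists_le_u
  refine Negligible.tendsto_zero (S := S) (Y := S.E₀) ?_ (fun t ht => S.hasDerivAt_gap ht)
    (fun t ht => S.gap_nonneg ht) fun t ht => S.gap_le ht
  refine Negligible.add ((S.negligible_integral_θ_sub_slope_sq.const_mul
    (c := (4 * c)⁻¹) (by positivity)).mono ?_) S.negligible_gap
  filter_upwards [hcu, eventually_ge_atTop 0] with t hct ht
  obtain ⟨-, -, hθ, hvx, -⟩ := S.continuousOn_slice ht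
  have hs := S.continuousOn_stress ht
  rw [← intervalIntegral.integral_neg, ← intervalIntegral.integral_const_mul]
  refine integral_unit_mono (by fun_prop) (by fun_prop) fun x hx => ?_
  have hup := S.hu_pos x hx t ht
  have h1 : -((S.vx x t - S.slope t) * S.stress x t)
      = (4 * S.u x t)⁻¹ * ((S.θ x t - S.slope t) ^ 2
        - (2 * (S.vx x t - S.θ x t) + (S.θ x t - S.slope t)) ^ 2) := by
    unfold stress
    field_simp
    ring
  rw [h1]
  have h2 : (4 * S.u x t)⁻¹ ≤ (4 * c)⁻¹ := by
    gcongr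
    exact hct x hx
  refine le_trans ?_ (mul_le_mul_of_nonneg_right h2 (sq_nonneg _))
  refine mul_le_mul_of_nonneg_left ?_ (by positivity)
  linarith [sq_nonneg (2 * (S.vx x t - S.θ x t) + (S.θ x t - S.slope t))]

lemma A_add_sq_eq (t : ℝ) : S.A + S.A ^ 2 / 24 = S.meanθ t + S.slope t ^ 2 / 24 + S.gap t := by
  have h0 : 0 ≤ 2 * S.E₀ - S.meanV ^ 2 := by
    have h1 := S.gap_nonneg le_rfl
    have h2 := S.meanθ_pos le_rfl
    unfold gap at h1
    linarith [sq_nonneg (S.slope 0)]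
  have h1 := Real.sq_sqrt (show 0 ≤ 36 + 3 * (2 * S.E₀ - S.meanV ^ 2) by linarith)
  have hA : S.A = 2 * √(36 + 3 * (2 * S.E₀ - S.meanV ^ 2)) - 12 := rfl
  rw [hA, gap]
  linarith

lemma A_nonneg : 0 ≤ S.A := by
  have h0 : 0 ≤ 2 * S.E₀ - S.meanV ^ 2 := by
    have h1 := S.gap_nonneg le_rfl
    have h2 := S.meanθ_pos le_rfl
    unfold gap at h1
    linarith [sq_nonneg (S.slope 0)]
  have hA : S.A = 2 * √(36 + 3 * (2 * S.E₀ - S.meanV ^ 2)) - 12 := rfl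
  have h1 : 6 ≤ √(36 + 3 * (2 * S.E₀ - S.meanV ^ 2)) :=
    Real.le_sqrt_of_sq_le (by linarith)
  linarith

lemma tendsto_slope : Tendsto S.slope atTop (𝓝 S.A) := by
  have hE := S.E₀_pos
  have hA := S.A_nonneg
  set B := 6 * S.E₀ + 3 + S.A with hB_def
  have hB : 0 < B := by positivity
  have hbd : ∀ t ≥ 0, |S.slope t - S.A| ≤ B := fun t ht => by
    have := abs_le.1 (S.abs_slope_le ht)
    exact abs_le.2 ⟨by linarith, by linarith⟩
  have hsq : Tendsto (fun t => (S.slope t - S.A) ^ 2) atTop (𝓝 0) := by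
    refine Negligible.tendsto_zero (S := S) (Y := B ^ 2) ?_
      (fun t ht => ((S.hasDerivAt_slope ht).sub_const S.A).pow 2)
      (fun t _ => sq_nonneg _) fun t ht => sq_le_sq' (abs_le.1 (hbd t ht)).1 (abs_le.1 (hbd t ht)).2
    refine ((S.negligible_integral_abs_stress.const_mul (c := 24 * B) (by positivity)).add
      ((S.negligible_abs_slope_sub_meanθ.add S.negligible_gap).const_mul
        (c := B + B ^ 2 / 24) (by positivity))).mono ?_
    filter_upwards [eventually_ge_atTop 0] with t ht
    have hs := S.continuousOn_stress ht
    have h1 : |∫ x in (0:ℝ)..1, S.stress x t| ≤ ∫ x in (0:ℝ)..1, |S.stress x t| :=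
      intervalIntegral.abs_integral_le_integral_abs zero_le_one
    have he := hbd t ht
    have hid := S.A_add_sq_eq t
    have hm := S.meanθ_pos ht
    have hg := S.gap_nonneg ht
    set I := ∫ x in (0:ℝ)..1, S.stress x t
    set d := S.slope t - S.meanθ t with hd_def
    set e := S.slope t - S.A with he_def
    have h2 : -(e * I) ≤ B * ∫ x in (0:ℝ)..1, |S.stress x t| :=
      (neg_le_abs _).trans (by
        rw [abs_mul]
        exact mul_le_mul he h1 (abs_nonneg _) hB.le)
    have h3 : e ^ 2 ≤ (B + B ^ 2 / 24) * (|d| + S.gap t) := by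
      have h4 : e ^ 2 + e ^ 2 * (S.slope t + S.A) / 24 = e * d - e * S.gap t := by
        have h5 : e + e * (S.slope t + S.A) / 24 = d - S.gap t := by
          rw [he_def, hd_def]
          linarith
        linear_combination e * h5
      have h5 : e * d ≤ B * |d| := (le_abs_self _).trans (by
        rw [abs_mul]
        exact mul_le_mul_of_nonneg_right he (abs_nonneg _))
      have h6 : -(e * S.gap t) ≤ B * S.gap t := (neg_le_abs _).trans (by
        rw [abs_mul, abs_of_nonneg hg]
        exact mul_le_mul_of_nonneg_right he hg)
      have h7 : e ^ 2 ≤ B ^ 2 := sq_le_sq' (abs_le.1 he).1 (abs_le.1 he).2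
      have h8 : -(e ^ 2 * (S.slope t + S.A)) ≤ e ^ 2 * |d| := by
        have : -(S.slope t + S.A) ≤ |d| := by linarith [neg_abs_le d]
        linarith [mul_le_mul_of_nonneg_left this (sq_nonneg e)]
      have h9 := mul_le_mul_of_nonneg_right h7 (abs_nonneg d)
      have h10 : 0 ≤ B ^ 2 * S.gap t := by positivity
      linarith
    norm_num
    linarith
  have habs : Tendsto (fun t => |S.slope t - S.A|) atTop (𝓝 0) := by
    have := hsq.sqrt
    simpa only [Real.sqrt_sq_eq_abs, Real.sqrt_zero] using this
  simpa using ((tendsto_zero_iff_abs_tendsto_zero _).2 habs).add_const S.A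

lemma tendsto_meanθ : Tendsto S.meanθ atTop (𝓝 S.A) := by
  have h : S.meanθ = fun t => S.A + S.A ^ 2 / 24 - S.slope t ^ 2 / 24 - S.gap t :=
    funext fun t => by linarith [S.A_add_sq_eq t]
  rw [h]
  have hlim := (((S.tendsto_slope.pow 2).div_const 24).const_sub (S.A + S.A ^ 2 / 24)).sub
    S.tendsto_gap
  rwa [show S.A + S.A ^ 2 / 24 - S.A ^ 2 / 24 - 0 = S.A by ring] at hlim

lemma eventually_abs_phase_lt {ε : ℝ} (hε : 0 < ε) :
    ∀ᶠ t in atTop, ∀ x ∈ Icc (0:ℝ) 1, |S.phase x t| < ε := by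
  have hlim : Tendsto (fun t => (2 * S.gap t / ε + |S.slope t - S.A|)) atTop (𝓝 0) := by
    simpa using ((S.tendsto_gap.const_mul 2).div_const ε).add (S.tendsto_slope.sub_const S.A).abs
  filter_upwards [hlim.eventually_lt_const (show 0 < ε / 2 by positivity),
    eventually_ge_atTop 0] with t hlt ht x hx
  have hv := (S.continuousOn_slice ht).2.1
  have hr := S.continuousOn_residual ht
  have h := abs_integral_sub_le (f := fun y => S.v y t - S.meanV - S.A * (y - 1 / 2))
    (g := fun y => ε / 4 + (1 / ε) * S.residual y t ^ 2 + |S.slope t - S.A|)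
    (by fun_prop) (by fun_prop) (fun y hy => by
      have h1 : S.v y t - S.meanV - S.A * (y - 1 / 2)
          = S.residual y t + (S.slope t - S.A) * (y - 1 / 2) := by
        unfold residual
        ring
      have h2 : |S.residual y t| ≤ ε / 4 + (1 / ε) * S.residual y t ^ 2 := by
        rw [← sq_abs (S.residual y t)]
        set a := |S.residual y t|
        have h4 : ε / 4 + (1 / ε) * a ^ 2 - a = (ε / 2 - a) ^ 2 / ε := by
          field_simp
          ring
        have h5 : 0 ≤ (ε / 2 - a) ^ 2 / ε := by positivity
        linarith
      have h3 : |(S.slope t - S.A) * (y - 1 / 2)| ≤ |S.slope t - S.A| * 1 := by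
        rw [abs_mul]
        exact mul_le_mul_of_nonneg_left (abs_le.2 ⟨by linarith [hy.1], by linarith [hy.2]⟩)
          (abs_nonneg _)
      rw [h1]
      exact (abs_add_le _ _).trans (by linarith))
    (left_mem_Icc.2 zero_le_one) hx hx.1
  rw [integral_unit_add (by fun_prop) (by fun_prop), integral_unit_add (by fun_prop) (by fun_prop),
    intervalIntegral.integral_const_mul, S.integral_residual_sq ht] at h
  simp only [intervalIntegral.integral_const, sub_zero, one_smul] at h
  have h6 : 1 / ε * (2 * S.gap t) = 2 * S.gap t / ε := by ring
  rw [h6] at h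
  unfold phase
  linarith

lemma eventually_abs_exp_phase_sub_one_lt {ε : ℝ} (hε : 0 < ε) :
    ∀ᶠ t in atTop, ∀ x ∈ Icc (0:ℝ) 1,
      |rexp (S.phase x t) - 1| < ε ∧ |rexp (-S.phase x t) - 1| < ε := by
  obtain ⟨δ, hδ, h⟩ := Metric.continuousAt_iff.1 (Real.continuous_exp.continuousAt (x := 0)) ε hε
  simp only [Real.dist_eq, sub_zero, Real.exp_zero] at h
  filter_upwards [S.eventually_abs_phase_lt hδ] with t ht x hx
  exact ⟨h (ht x hx), h (by rw [abs_neg]; exact ht x hx)⟩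

lemma eventually_abs_vol_sub_A_le {ε : ℝ} (hε : 0 < ε) :
    ∀ᶠ t in atTop, ∀ x ∈ Icc (0:ℝ) 1, |S.vol x t - S.A| ≤ ε := by
  obtain ⟨P, hP⟩ := S.exists_abs_phase_le
  obtain ⟨N, hN, hvol⟩ := S.exists_vol_le
  obtain ⟨l, hl⟩ := S.exists_tendsto_entropy
  have hA := S.A_nonneg
  set E := rexp P with hE_def
  have hE : 0 < E := exp_pos _
  set δ := ε / (4 * (2 * E + S.A + 1)) with hδ_def
  have hδ : 0 < δ := by positivity
  obtain ⟨C, hC⟩ := S.exists_abs_θ_sub_meanθ_le hδ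
  have hmean : ∀ᶠ t in atTop, |S.meanθ t - S.A| < δ := by
    simpa [Real.dist_eq] using Metric.tendsto_nhds.1 S.tendsto_meanθ δ hδ
  obtain ⟨T, hT⟩ := eventually_atTop.1 ((hmean.and
    (S.eventually_abs_exp_phase_sub_one_lt hδ)).and (eventually_ge_atTop 1))
  have hT1 : 1 ≤ T := (hT T le_rfl).2
  have hforce : ∀ t ≥ T, ∀ x ∈ Icc (0:ℝ) 1,
      |S.θ x t * rexp (-S.phase x t) - S.A| ≤ ε / 4 + E * C * S.V t := fun t ht x hx => by
    obtain ⟨⟨h1, h2⟩, ht1⟩ := hT t ht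
    have h3 := hC t ht1 x hx
    have h4 : rexp (-S.phase x t) ≤ E :=
      exp_le_exp.2 (by linarith [(abs_le.1 (hP x hx t (by linarith))).1])
    have h5 : |S.θ x t - S.A| ≤ 2 * δ + C * S.V t := by
      have h6 := abs_le.1 h3
      have h7 := abs_lt.1 h1
      exact abs_le.2 ⟨by linarith, by linarith⟩
    calc |S.θ x t * rexp (-S.phase x t) - S.A|
        = |(S.θ x t - S.A) * rexp (-S.phase x t) + S.A * (rexp (-S.phase x t) - 1)| := by ring_nf
      _ ≤ |S.θ x t - S.A| * rexp (-S.phase x t) + S.A * |rexp (-S.phase x t) - 1| := by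
          refine (abs_add_le _ _).trans (le_of_eq ?_)
          rw [abs_mul, abs_mul, abs_of_pos (exp_pos _), abs_of_nonneg hA]
      _ ≤ (2 * δ + C * S.V t) * E + S.A * δ :=
          add_le_add (mul_le_mul h5 h4 (exp_pos _).le ((abs_nonneg _).trans h5))
            (mul_le_mul_of_nonneg_left (h2 x hx).2.le hA)
      _ ≤ δ * (2 * E + S.A + 1) + E * C * S.V t := by linarith
      _ = ε / 4 + E * C * S.V t := by
          rw [hδ_def]
          field_simp
  obtain ⟨T', hTT', h⟩ := eventually_le_of_damped (fun t ht => S.hasDerivAt_entropy ht) hl (E * C) T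
    (N + S.A) (ε := ε / 4) (by positivity)
  filter_upwards [eventually_ge_atTop T'] with t ht x hx
  have h1 := h (fun s => S.vol x s - S.A) _
    (fun s hs => (S.hasDerivAt_vol hx (by linarith)).sub_const _)
    (fun s hs => by linarith [(abs_le.1 (hforce s hs x hx)).2])
    (fun s hs => by linarith [hvol s (by linarith) x hx]) t ht
  have h2 := h (fun s => S.A - S.vol x s) _
    (fun s hs => (S.hasDerivAt_vol hx (by linarith)).const_sub _)
    (fun s hs => by linarith [(abs_le.1 (hforce s hs x hx)).1])
    (fun s hs => by linarith [S.vol_nonneg hx (show 0 ≤ s by linarith)]) t ht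
  exact abs_le.2 ⟨by linarith, by linarith⟩

lemma eventually_abs_u_sub_A_lt {ε : ℝ} (hε : 0 < ε) :
    ∀ᶠ t in atTop, ∀ x ∈ Icc (0:ℝ) 1, |S.u x t - S.A| < ε := by
  obtain ⟨N, hN, hvol⟩ := S.exists_vol_le
  filter_upwards [S.eventually_abs_vol_sub_A_le (half_pos hε),
    S.eventually_abs_exp_phase_sub_one_lt (show 0 < ε / 2 / N by positivity),
    eventually_ge_atTop 1] with t h1 h2 ht x hx
  have h3 := S.vol_nonneg hx (zero_le_one.trans ht)
  have h4 : S.vol x t * |rexp (S.phase x t) - 1| < ε / 2 :=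
    calc S.vol x t * |rexp (S.phase x t) - 1| ≤ N * |rexp (S.phase x t) - 1| :=
          mul_le_mul_of_nonneg_right (hvol t ht x hx) (abs_nonneg _)
      _ < ε / 2 := by
          rw [mul_comm]
          exact (lt_div_iff₀ hN).1 (h2 x hx).1
  calc |S.u x t - S.A|
      = |S.vol x t * (rexp (S.phase x t) - 1) + (S.vol x t - S.A)| := by
        rw [u_eq]
        ring_nf
    _ ≤ S.vol x t * |rexp (S.phase x t) - 1| + |S.vol x t - S.A| := by
        refine (abs_add_le _ _).trans (le_of_eq ?_)
        rw [abs_mul, abs_of_nonneg h3]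
    _ < ε := by linarith [h1 x hx]

end NSSol

/-- As `t → ∞`, `u(·,t) → A` uniformly on `[0,1]` and `∫₀¹ θ(·,t) → A`. -/
theorem u_and_mean_theta_converge (S : NSSol) :
    (∀ ε > (0:ℝ), ∃ T : ℝ, ∀ t ≥ T, ∀ x ∈ Icc (0:ℝ) 1, |S.u x t - S.A| < ε) ∧
    Tendsto (fun t => ∫ x in (0:ℝ)..1, S.θ x t) atTop (𝓝 S.A) := by
  exact ⟨fun _ hε => eventually_atTop.1 (S.eventually_abs_u_sub_A_lt hε), S.tendsto_meanθ⟩
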